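/- arXiv:1509.04372 — 6 statements merged into one kernel-verified Lean document; each statement's English description precedes it below -/
import Mathlib

section
/- Let a be a letter and let 0 < k < ℓ be integers. Then for every ε > 0 there exists N such that every word W over an alphabet containing a with |W| ≥ N satisfies ℓ·(d(a^k, W) − 1) ≤ k·(d(a^ℓ, W) − 1) + ε. -/
open Filter

/-- `U` is an instance of `V`: image of `V` under a nonerasing substitution. -/
def IsInstance {Γ β : Type*} (V : List Γ) (U : List β) : Prop :=
  ∃ φ : Γ → List β, (∀ x ∈ V, φ x ≠ []) ∧ U = (V.map φ).flatten

/-- `W` encounters `V`: some factor of `W` is an instance of `V`. -/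
def Encounters {Γ β : Type*} (V : List Γ) (W : List β) : Prop :=
  ∃ U : List β, U <:+: W ∧ IsInstance V U

/-- Zimin words over alphabet ℕ. -/
def Zimin : ℕ → List ℕ
  | 0 => []
  | n + 1 => Zimin n ++ [n] ++ Zimin n

/-- Least M such that every q-ary word of length M encounters Z_n. -/
noncomputable def fZ (n q : ℕ) : ℕ :=
  sInf {M | ∀ W : List (Fin q), W.length = M → Encounters (Zimin n) W}

/-- Exponential tower with b copies of a. -/
def tower (a : ℕ) : ℕ → ℕ
  | 0 => 1
  | b + 1 => a ^ tower a b

/-- Number of length-M q-ary words that are instances of V. -/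
noncomputable def instCount (V : List ℕ) (q M : ℕ) : ℕ :=
  Nat.card {W : Fin M → Fin q // IsInstance V (List.ofFn W)}

/-- Factor density d(V,W). -/
noncomputable def factorDensity {α : Type*} [DecidableEq α] (V W : List α) : ℝ :=
  (((((Finset.range (W.length + 1)) ×ˢ (Finset.range (W.length + 1))).filter
      (fun p => p.1 < p.2 ∧ (W.drop p.1).take (p.2 - p.1) = V)).card : ℝ)) /
    ((W.length : ℝ) + 1 - (V.length : ℝ))

/-- Number of substrings of W (given by position pairs) that are V-instances. -/
noncomputable def instSubCount {Γ β : Type*} (V : List Γ) (W : List β) : ℕ :=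
  Nat.card {p : ℕ × ℕ //
    p.1 < p.2 ∧ p.2 ≤ W.length ∧ IsInstance V ((W.drop p.1).take (p.2 - p.1))}

/-- Instance density δ(V,W). -/
noncomputable def instDensity {Γ β : Type*} (V : List Γ) (W : List β) : ℝ :=
  (instSubCount V W : ℝ) / ((W.length + 1).choose 2 : ℝ)

/-- q-liminf density of V. -/
noncomputable def liminfDensity {Γ : Type*} (V : List Γ) (q : ℕ) : ℝ :=
  Filter.liminf (fun W : List (Fin q) => instDensity V W) (Filter.comap List.length Filter.atTop)

/-- Expected instance density of V in a uniformly random q-ary word of length n. -/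
noncomputable def expDensity {Γ : Type*} (V : List Γ) (q n : ℕ) : ℝ :=
  (∑ W : Fin n → Fin q, instDensity V (List.ofFn W)) / (q : ℝ) ^ n

/-- Variance of the instance density of V in a uniformly random q-ary word of length n. -/
noncomputable def varDensity {Γ : Type*} (V : List Γ) (q n : ℕ) : ℝ :=
  (∑ W : Fin n → Fin q, (instDensity V (List.ofFn W) - expDensity V q n) ^ 2) / (q : ℝ) ^ n

/-- Probability that a uniformly random q-ary word of length n is a V-instance. -/
noncomputable def instProb {Γ : Type*} (V : List Γ) (q n : ℕ) : ℝ :=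
  (Nat.card {W : Fin n → Fin q // IsInstance V (List.ofFn W)} : ℝ) / (q : ℝ) ^ n

/-- V is doubled: every letter occurring in V occurs at least twice. -/
def Doubled {Γ : Type*} [DecidableEq Γ] (V : List Γ) : Prop :=
  ∀ x ∈ V, 2 ≤ V.count x

/-- Number of letter recurrences ‖V‖ = |V| - |L(V)|. -/
def recurCount {Γ : Type*} [DecidableEq Γ] (V : List Γ) : ℕ :=
  V.length - V.dedup.length

noncomputable def badCnt (Q : ℕ → Prop) (n m : ℕ) : ℕ := by
  classical exact ((Finset.range n).filter (fun i => ∃ j < m, Q (i + j))).card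

noncomputable def newCnt (Q : ℕ → Prop) (n m : ℕ) : ℕ := by
  classical exact ((Finset.range n).filter (fun i => Q (i + m) ∧ ∀ j < m, ¬ Q (i + j))).card

theorem badCnt_succ (Q : ℕ → Prop) (n m : ℕ) :
    badCnt Q n (m + 1) = badCnt Q n m + newCnt Q n m := by
  classical
  unfold badCnt newCnt
  rw [← Finset.card_union_of_disjoint]
  · congr 1
    ext i
    simp only [Finset.mem_filter, Finset.mem_union, Finset.mem_range]
    constructor
    · rintro ⟨hi, j, hj, hq⟩
      by_cases h : ∃ j < m, Q (i + j)
      · exact Or.inl ⟨hi, h⟩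
      · push Not at h
        have : j = m := by
          by_contra hne
          exact h j (by omega) hq
        subst this
        exact Or.inr ⟨hi, hq, h⟩
    · rintro (⟨hi, j, hj, hq⟩ | ⟨hi, hq, h⟩)
      · exact ⟨hi, j, by omega, hq⟩
      · exact ⟨hi, m, by omega, hq⟩
  · rw [Finset.disjoint_filter]
    rintro i - ⟨j, hj, hq⟩ ⟨-, h⟩
    exact h j hj hq

theorem newCnt_anti (Q : ℕ → Prop) (n : ℕ) (hQ : ∀ i, Q i → i < n) :
    Antitone (newCnt Q n) := by
  classical
  refine antitone_nat_of_succ_le fun m => ?_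
  unfold newCnt
  refine Finset.card_le_card_of_injOn (fun i => i + 1) ?_ ?_
  · intro i hi
    simp only [Finset.coe_filter, Finset.mem_range, Set.mem_setOf_eq] at hi ⊢
    obtain ⟨hi, hq, h⟩ := hi
    have h1 := hQ _ hq
    refine ⟨by omega, ?_, ?_⟩
    · rwa [show i + 1 + m = i + (m + 1) by ring]
    · intro j hj
      rw [show i + 1 + j = i + (j + 1) by ring]
      exact h _ (by omega)
  · intro x _ y _ h
    simpa using h

theorem badCnt_zero (Q : ℕ → Prop) (n : ℕ) : badCnt Q n 0 = 0 := by
  simp [badCnt]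

theorem newCnt_mul_le (Q : ℕ → Prop) (n : ℕ) (hQ : ∀ i, Q i → i < n) (m : ℕ) :
    newCnt Q n m * m ≤ badCnt Q n m := by
  suffices h : ∀ r ≤ m, newCnt Q n m * r ≤ badCnt Q n r from h m le_rfl
  intro r
  induction r with
  | zero => intro _; simp
  | succ r ih =>
    intro hr
    rw [badCnt_succ]
    have h1 := ih (by omega)
    have h2 := newCnt_anti Q n hQ (show r ≤ m by omega)
    rw [mul_add, mul_one]
    omega

theorem badCnt_mul_le (Q : ℕ → Prop) (n : ℕ) (hQ : ∀ i, Q i → i < n) (k ℓ : ℕ) (hk : 0 < k)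
    (hkl : k ≤ ℓ) : k * badCnt Q n ℓ ≤ ℓ * badCnt Q n k := by
  induction ℓ, hkl using Nat.le_induction with
  | base => exact le_rfl
  | succ m hm ih =>
    have h1 := newCnt_mul_le Q n hQ m
    have h2 := badCnt_succ Q n m
    have hm0 : 0 < m := by omega
    refine Nat.le_of_mul_le_mul_left ?_ hm0
    rw [h2]
    have h3 := Nat.mul_le_mul_left k h1
    have h4 := Nat.mul_le_mul_left (m + 1) ih
    nlinarith

noncomputable def goodCnt (Q : ℕ → Prop) (n m : ℕ) : ℕ := by
  classical exact ((Finset.range (n + 1)).filter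
    (fun i => i + m ≤ n ∧ ∀ j < m, ¬ Q (i + j))).card

theorem good_add_bad_le (Q : ℕ → Prop) (n m : ℕ) : goodCnt Q n m + badCnt Q n m ≤ n + 1 := by
  classical
  unfold goodCnt badCnt
  rw [← Finset.card_union_of_disjoint]
  · calc _ ≤ (Finset.range (n + 1)).card := Finset.card_le_card (by
          intro i hi
          simp only [Finset.mem_filter, Finset.mem_union, Finset.mem_range] at hi ⊢
          omega)
      _ = _ := by simp
  · rw [Finset.disjoint_left]
    intro i h1 h2
    simp only [Finset.mem_filter] at h1 h2
    obtain ⟨j, hj, hq⟩ := h2.2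
    exact h1.2.2 j hj hq

theorem le_good_add_bad (Q : ℕ → Prop) (n m : ℕ) (hm : 0 < m) :
    n + 1 ≤ goodCnt Q n m + badCnt Q n m + m := by
  classical
  unfold goodCnt badCnt
  have h := Finset.card_union_le ((Finset.range (n + 1)).filter
    (fun i => i + m ≤ n ∧ ∀ j < m, ¬ Q (i + j)))
    ((Finset.range n).filter (fun i => ∃ j < m, Q (i + j)))
  have h2 : (Finset.range (n + 1 - m)).card ≤ _ := Finset.card_le_card
    (t := ((Finset.range (n + 1)).filter
    (fun i => i + m ≤ n ∧ ∀ j < m, ¬ Q (i + j))) ∪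
    ((Finset.range n).filter (fun i => ∃ j < m, Q (i + j)))) (by
      intro i hi
      simp only [Finset.mem_filter, Finset.mem_union, Finset.mem_range] at hi ⊢
      by_cases hh : ∃ j < m, Q (i + j)
      · exact Or.inr ⟨by omega, hh⟩
      · push Not at hh
        exact Or.inl ⟨by omega, by omega, hh⟩)
  rw [Finset.card_range] at h2
  omega

theorem window_iff {α : Type*} (a : α) (W : List α) (m i r : ℕ)
    (hi : i < r) (hr : r ≤ W.length) :
    (W.drop i).take (r - i) = List.replicate m a ↔
      r = i + m ∧ ∀ j < m, ¬ (i + j < W.length ∧ W[i + j]? ≠ some a) := by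
  constructor
  · intro h
    have hl := congrArg List.length h
    simp only [List.length_take, List.length_drop, List.length_replicate] at hl
    have hrm : r = i + m := by omega
    refine ⟨hrm, fun j hj hq => hq.2 ?_⟩
    have h3 := congrArg (fun L => L[j]?) h
    simp only [List.getElem?_take, List.getElem?_drop, List.getElem?_replicate] at h3
    rwa [if_pos (by omega), if_pos hj] at h3
  · rintro ⟨hrm, h⟩
    apply List.ext_getElem?
    intro j
    simp only [List.getElem?_take, List.getElem?_drop, List.getElem?_replicate]
    by_cases hj : j < m
    · rw [if_pos (by omega), if_pos hj]
      by_contra hne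
      exact h j hj ⟨by omega, hne⟩
    · rw [if_neg (by omega), if_neg hj]

theorem card_eq_good {α : Type*} [DecidableEq α] (a : α) (W : List α) (m : ℕ) (hm : 0 < m) :
    (((Finset.range (W.length + 1)) ×ˢ (Finset.range (W.length + 1))).filter
      (fun p => p.1 < p.2 ∧ (W.drop p.1).take (p.2 - p.1) = List.replicate m a)).card =
    goodCnt (fun i => i < W.length ∧ W[i]? ≠ some a) W.length m := by
  classical
  unfold goodCnt
  symm
  refine Finset.card_bij (fun i _ => (i, i + m)) ?_ ?_ ?_
  · intro i hi
    simp only [Finset.mem_filter, Finset.mem_product, Finset.mem_range] at hi ⊢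
    refine ⟨⟨hi.1, by omega⟩, by omega, ?_⟩
    exact (window_iff a W m i (i + m) (by omega) hi.2.1).2 ⟨rfl, hi.2.2⟩
  · intro x _ y _ h
    exact (Prod.mk.inj h).1
  · rintro ⟨i, r⟩ hp
    simp only [Finset.mem_filter, Finset.mem_product, Finset.mem_range] at hp
    obtain ⟨⟨h1, h2⟩, h3, h4⟩ := hp
    obtain ⟨h5, h6⟩ := (window_iff a W m i r h3 (by omega)).1 h4
    subst h5
    refine ⟨i, ?_, rfl⟩
    simp only [Finset.mem_filter, Finset.mem_range]
    exact ⟨h1, by omega, h6⟩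

theorem stmt6 {α : Type*} [DecidableEq α] (a : α) (k ℓ : ℕ) (hk : 0 < k) (hkl : k < ℓ)
    (ε : ℝ) (hε : 0 < ε) :
    ∃ N : ℕ, ∀ W : List α, N ≤ W.length →
      (ℓ : ℝ) * (factorDensity (List.replicate k a) W - 1) ≤
        (k : ℝ) * (factorDensity (List.replicate ℓ a) W - 1) + ε := by
  obtain ⟨M, hM⟩ := exists_nat_gt (2 * (ℓ : ℝ) * k / ε)
  refine ⟨M + ℓ, fun W hW => ?_⟩
  have hl : 0 < ℓ := by omega
  unfold factorDensity
  rw [card_eq_good a W k hk, card_eq_good a W ℓ hl, List.length_replicate, List.length_replicate]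
  set Q : ℕ → Prop := fun i => i < W.length ∧ W[i]? ≠ some a with hQ
  set n := W.length with hn
  have e1 := good_add_bad_le Q n k
  have e2 := le_good_add_bad Q n ℓ hl
  have e3 := badCnt_mul_le Q n (fun i hi => hi.1) k ℓ hk hkl.le
  generalize goodCnt Q n k = x at *
  generalize goodCnt Q n ℓ = y at *
  generalize badCnt Q n k = f at *
  generalize badCnt Q n ℓ = g at *
  have r1 : (x : ℝ) + f ≤ n + 1 := by exact_mod_cast e1
  have r2 : (n : ℝ) + 1 ≤ y + g + ℓ := by exact_mod_cast e2
  have r3 : (k : ℝ) * g ≤ ℓ * f := by exact_mod_cast e3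
  have r4 : (M : ℝ) + ℓ ≤ n := by exact_mod_cast hW
  have r5 : (0 : ℝ) < k := by exact_mod_cast hk
  have r6 : (k : ℝ) < ℓ := by exact_mod_cast hkl
  have r7 : (0 : ℝ) ≤ y := by positivity
  have r8 : 2 * (ℓ : ℝ) * k < M * ε := by rwa [div_lt_iff₀ hε] at hM
  have hM0 : (0 : ℝ) ≤ M := by positivity
  have pA : (0 : ℝ) < (n : ℝ) + 1 - k := by linarith
  have pB : (0 : ℝ) < (n : ℝ) + 1 - ℓ := by linarith
  set A : ℝ := (n : ℝ) + 1 - k with hA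
  set B : ℝ := (n : ℝ) + 1 - ℓ with hB
  have s1 : (y : ℝ) / A ≤ y / B :=
    div_le_div_of_nonneg_left r7 pB (by linarith)
  have s2 : (ℓ : ℝ) * (x / A - 1) ≤ k * (y / A - 1) + ε := by
    have : (ℓ : ℝ) * (x - A) ≤ k * (y - A) + ε * A := by
      have t1 : M * ε ≤ ε * A := by nlinarith
      have t2 : (ℓ : ℝ) * (x - A) ≤ ℓ * (k - f) :=
        mul_le_mul_of_nonneg_left (by linarith) (by linarith)
      have t3 : (k : ℝ) * (-g - ℓ + k) ≤ k * (y - A) :=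
        mul_le_mul_of_nonneg_left (by linarith) (by linarith)
      nlinarith
    have h1 : (ℓ : ℝ) * (x / A - 1) = ℓ * (x - A) / A := by field_simp
    have h2 : (k : ℝ) * (y / A - 1) + ε = (k * (y - A) + ε * A) / A := by field_simp
    rw [h1, h2]
    gcongr
  have s3 := mul_le_mul_of_nonneg_left s1 r5.le
  linarith
end

section
/- Let V be a nonempty word that is not doubled (i.e., some letter occurs exactly once in V) and let q be a positive integer. Then the limit I(V,q) = lim_{n→∞} I_n(V,q) exists and satisfies I(V,q) ≥ q^{−||V||} > 0. -/
open Filter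

namespace ZW
open MeasureTheory

noncomputable def mu (q : ℕ) [NeZero q] : Measure (ℕ ⊕ ℕ → Fin q) :=
  Measure.infinitePi (fun _ => (PMF.uniformOfFintype (Fin q)).toMeasure)

instance (q : ℕ) [NeZero q] : IsProbabilityMeasure (mu q) := by
  unfold mu; infer_instance

lemma mu_single {q : ℕ} [NeZero q] {T : Type} [Fintype T] (e : T → ℕ ⊕ ℕ)
    (he : Function.Injective e) (w : T → Fin q) :
    mu q {ω | ω ∘ e = w} = ((q : ENNReal)⁻¹) ^ Fintype.card T := by
  have h1 : {ω : ℕ ⊕ ℕ → Fin q | ω ∘ e = w} =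
      Set.pi (Finset.univ.map ⟨e, he⟩ : Finset (ℕ ⊕ ℕ)) (fun i => {a | ∀ j, e j = i → a = w j}) := by
    ext ω
    simp only [Set.mem_ofPred_eq, Set.mem_pi, Finset.coe_map, Function.Embedding.coeFn_mk,
      Finset.coe_univ, Set.image_univ, Set.mem_range]
    constructor
    · rintro rfl i - j rfl
      rfl
    · intro h
      funext j
      exact h (e j) ⟨j, rfl⟩ j rfl
  have h3 := Measure.infinitePi_pi
    (μ := fun _ : ℕ ⊕ ℕ => (PMF.uniformOfFintype (Fin q)).toMeasure)
    (s := Finset.univ.map ⟨e, he⟩) (t := fun i => {a | ∀ j, e j = i → a = w j})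
    (fun i _ => MeasurableSet.of_discrete)
  rw [h1, mu]
  refine h3.trans ?_
  rw [Finset.prod_map]
  have h2 : ∀ j : T, ({a | ∀ j', e j' = e j → a = w j'} : Set (Fin q)) = {w j} := by
    intro j
    ext a
    simp only [Set.mem_ofPred_eq, Set.mem_singleton_iff]
    constructor
    · intro h
      exact h j rfl
    · intro h j' hj
      rw [he hj]; exact h
  simp only [Function.Embedding.coeFn_mk, h2]
  simp

lemma meas_comp {q : ℕ} {T : Type} (e : T → ℕ ⊕ ℕ) :
    Measurable (fun ω : ℕ ⊕ ℕ → Fin q => ω ∘ e) :=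
  measurable_pi_lambda _ (fun j => measurable_pi_apply (e j))

lemma mu_comp {q : ℕ} [NeZero q] {T : Type} [Fintype T] (e : T → ℕ ⊕ ℕ)
    (he : Function.Injective e) (S : Set (T → Fin q)) :
    (mu q).real {ω | ω ∘ e ∈ S} = (Nat.card S : ℝ) / (q : ℝ) ^ Fintype.card T := by
  classical
  have h0 : {ω : ℕ ⊕ ℕ → Fin q | ω ∘ e ∈ S} = ⋃ w ∈ S.toFinset, {ω | ω ∘ e = w} := by
    ext ω; simp
  rw [h0, measureReal_biUnion_finset]
  · have : ∀ w : T → Fin q, (mu q).real {ω | ω ∘ e = w} = ((q : ℝ) ^ Fintype.card T)⁻¹ := by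
      intro w
      rw [Measure.real, mu_single e he w]
      simp
    simp only [this, Finset.sum_const, nsmul_eq_mul]
    rw [Nat.card_eq_fintype_card, Set.toFinset_card, div_eq_mul_inv]
  · intro a _ b _ hab
    refine Set.disjoint_left.2 ?_
    intro ω h1 h2
    exact hab (h1.symm.trans h2)
  · intro w _
    exact meas_comp e (measurableSet_singleton w)

def Occ {α : Type} (P : ℕ → α) : Prop :=
  ∀ (u : List α) (N : ℕ), ∃ k ≥ N, ∀ i (h : i < u.length), u[i] = P (k + i)

lemma ae_occ {q : ℕ} [NeZero q] (f : ℕ → ℕ ⊕ ℕ) (hf : Function.Injective f) :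
    ∀ᵐ ω ∂(mu q), Occ (ω ∘ f) := by
  classical
  unfold Occ
  rw [ae_all_iff]; intro u
  rw [ae_all_iff]; intro N
  rw [ae_iff]
  set bad := {a : ℕ ⊕ ℕ → Fin q | ¬∃ k ≥ N, ∀ i (h : i < u.length), u[i] = (a ∘ f) (k + i)} with hbad
  set m := u.length with hm
  set r : ℝ := ((q ^ m - 1 : ℕ) : ℝ) / (q : ℝ) ^ m with hr
  have hq : 0 < q := Nat.pos_of_ne_zero (NeZero.ne q)
  have hqm : 0 < q ^ m := pow_pos hq m
  have hr0 : 0 ≤ r := by positivity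
  have hr1 : r < 1 := by
    rw [hr, div_lt_one (by positivity)]
    have : (q ^ m - 1 : ℕ) < q ^ m := by omega
    exact_mod_cast this
  have key : ∀ k : ℕ, (mu q).real bad ≤ r ^ k := by
    intro k
    let e : Fin k × Fin m → ℕ ⊕ ℕ := fun p => f (N + (finProdFinEquiv p).val)
    have he : Function.Injective e := by
      intro a b hab
      have := hf hab
      have h2 : (finProdFinEquiv a).val = (finProdFinEquiv b).val := by omega
      exact finProdFinEquiv.injective (Fin.ext h2)
    let S : Set (Fin k × Fin m → Fin q) := {g | ∀ j, (fun i => g (j, i)) ≠ u.get}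
    have hsub : bad ⊆ {ω | ω ∘ e ∈ S} := by
      intro ω hω j hj
      apply hω
      refine ⟨N + m * j, by omega, ?_⟩
      intro i hi
      have := congrFun hj ⟨i, hi⟩
      simp only [List.get_eq_getElem] at this
      rw [← this]
      simp only [e, Function.comp, finProdFinEquiv_apply_val]
      congr 2; omega
    refine (measureReal_mono hsub).trans ?_
    rw [mu_comp e he S]
    have hc : Nat.card S ≤ (q ^ m - 1) ^ k := by
      have : Nat.card S ≤ Nat.card (Fin k → {v : Fin m → Fin q // v ≠ u.get}) := by
        refine Nat.card_le_card_of_injective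
          (fun (g : S) (j : Fin k) => (⟨fun i => g.1 (j, i), g.2 j⟩ : {v : Fin m → Fin q // v ≠ u.get})) ?_
        intro g g' h
        apply Subtype.ext
        funext p
        exact congrFun (congrArg Subtype.val (congrFun h p.1)) p.2
      refine this.trans (le_of_eq ?_)
      rw [Nat.card_eq_fintype_card, Fintype.card_fun, Fintype.card_fin]
      congr 1
      rw [Fintype.card_subtype_compl]
      simp
    rw [hr, div_pow, ← pow_mul]
    simp only [Fintype.card_prod, Fintype.card_fin]
    rw [mul_comm k m]
    gcongr
    exact_mod_cast hc
  have hz : (mu q).real bad ≤ 0 :=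
    ge_of_tendsto' (tendsto_pow_atTop_nhds_zero_of_lt_one hr0 hr1) key
  have : (mu q).real bad = 0 := le_antisymm hz measureReal_nonneg
  exact (measureReal_eq_zero_iff).1 this

def IsPre {α : Type} (u : List α) (P : ℕ → α) : Prop := ∀ i (h : i < u.length), u[i] = P i

lemma isPre_append {α : Type} {u v : List α} {P : ℕ → α} (hu : IsPre u P)
    (hv : ∀ i (h : i < v.length), v[i] = P (u.length + i)) : IsPre (u ++ v) P := by
  intro i h
  rw [List.getElem_append]
  split_ifs with h1
  · exact hu i h1
  · rw [hv]
    congr 1; omega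

def Ev {Γ : Type*} {α : Type} (A B : List Γ) (P S : ℕ → α) : Prop :=
  ∃ φ : Γ → List α, (∀ y ∈ A ++ B, φ y ≠ []) ∧ IsPre (A.map φ).flatten P ∧
    IsPre ((B.map φ).flatten).reverse S

lemma rev_map {Γ : Type*} {α : Type} (φ : Γ → List α) (B : List Γ) :
    (B.reverse.map (fun y => (φ y).reverse)).flatten = ((B.map φ).flatten).reverse := by
  rw [List.reverse_flatten, List.map_reverse, List.map_map]
  rfl

lemma Ev_symm {Γ : Type*} {α : Type} {A B : List Γ} {P S : ℕ → α} (h : Ev A B P S) :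
    Ev B.reverse A.reverse S P := by
  obtain ⟨φ, h1, h2, h3⟩ := h
  refine ⟨fun y => (φ y).reverse, ?_, ?_, ?_⟩
  · intro y hy
    have := h1 y (by simp at hy ⊢; tauto)
    simpa using this
  · rw [rev_map]; exact h3
  · rw [rev_map, List.reverse_reverse]; exact h2

lemma map_congr' {Γ : Type*} {α : Type} {φ ψ : Γ → List α} {A : List Γ}
    (h : ∀ y ∈ A, φ y = ψ y) : (A.map φ).flatten = (A.map ψ).flatten := by
  rw [List.map_congr_left h]

lemma step_left {Γ : Type*} [DecidableEq Γ] {α : Type} {A C B : List Γ} {y : Γ} {P S : ℕ → α}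
    (hP : Occ P) (hA : y ∉ A) (hC : y ∉ C) (hB : y ∉ B) (h : Ev A B P S) :
    Ev (A ++ y :: C) B P S := by
  obtain ⟨φ, h1, h2, h3⟩ := h
  let φ0 : Γ → List α := fun z => if z ∈ A ++ B then φ z else [P 0]
  set a := (A.map φ).flatten.length with ha
  obtain ⟨k, hk, hk2⟩ := hP ((C.map φ0).flatten) (a + 1)
  let w : List α := List.ofFn (fun i : Fin (k - a) => P (a + i))
  have hw : w.length = k - a := by simp [w]
  let φ1 : Γ → List α := fun z => if z = y then w else φ0 z
  have hA1 : (A.map φ1).flatten = (A.map φ).flatten := by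
    apply map_congr'
    intro z hz
    have : z ≠ y := by rintro rfl; exact hA hz
    simp [φ1, φ0, this, hz]
  have hB1 : (B.map φ1).flatten = (B.map φ).flatten := by
    apply map_congr'
    intro z hz
    have : z ≠ y := by rintro rfl; exact hB hz
    simp [φ1, φ0, this, hz]
  have hC1 : (C.map φ1).flatten = (C.map φ0).flatten := by
    apply map_congr'
    intro z hz
    have : z ≠ y := by rintro rfl; exact hC hz
    simp [φ1, this]
  refine ⟨φ1, ?_, ?_, ?_⟩
  · intro z _
    by_cases hz : z = y
    · simp only [φ1, hz, if_true]
      intro h0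
      rw [h0] at hw
      simp at hw; omega
    · by_cases hz2 : z ∈ A ++ B
      · simp only [φ1, φ0, hz, hz2, if_true, if_false]
        exact h1 z hz2
      · simp only [φ1, φ0, hz, hz2, if_false]
        simp
  · have : ((A ++ y :: C).map φ1).flatten = ((A.map φ).flatten ++ w) ++ (C.map φ0).flatten := by
      rw [List.map_append, List.flatten_append, List.map_cons, List.flatten_cons, hA1, hC1,
        List.append_assoc]
      simp [φ1]
    rw [this]
    apply isPre_append
    · apply isPre_append h2
      intro i hi
      simp [w, ha]
    · intro i hi
      rw [hk2 i hi]
      congr 1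
      rw [List.length_append, hw]; omega
  · rw [hB1]; exact h3

lemma step_right {Γ : Type*} [DecidableEq Γ] {α : Type} {A C B : List Γ} {y : Γ} {P S : ℕ → α}
    (hS : Occ S) (hA : y ∉ A) (hC : y ∉ C) (hB : y ∉ B) (h : Ev A B P S) :
    Ev A (C ++ y :: B) P S := by
  have h1 := Ev_symm h
  have h2 := step_left (C := C.reverse) (y := y) hS (by simpa using hB) (by simpa using hC)
    (by simpa using hA) h1
  have h3 := Ev_symm h2
  simpa using h3

lemma exists_core {Γ : Type*} [DecidableEq Γ] {α : Type} (n : ℕ) : ∀ A B : List Γ,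
    A.length + B.length = n →
    ∃ A1 A2 B1 B2 : List Γ, A = A1 ++ A2 ∧ B = B2 ++ B1 ∧
      (∀ y ∈ A1 ++ B1, 2 ≤ (A1 ++ B1).count y) ∧
      ∀ P S : ℕ → α, Occ P → Occ S → Ev A1 B1 P S → Ev A B P S := by
  induction n using Nat.strong_induction_on with
  | _ n ih =>
    intro A B hn
    by_cases hall : ∀ y ∈ A ++ B, 2 ≤ (A ++ B).count y
    · exact ⟨A, [], B, [], by simp, by simp, hall, fun _ _ _ _ h => h⟩
    · push Not at hall
      obtain ⟨y, hy, hc⟩ := hall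
      rw [List.count_append] at hc
      rcases List.mem_append.1 hy with hy | hy
      · obtain ⟨A', C, rfl⟩ := List.append_of_mem hy
        rw [List.count_append, List.count_cons_self] at hc
        have hA : y ∉ A' := by rw [← List.count_eq_zero]; omega
        have hC : y ∉ C := by rw [← List.count_eq_zero]; omega
        have hB : y ∉ B := by rw [← List.count_eq_zero]; omega
        obtain ⟨A1, A2, B1, B2, e1, e2, h1, h2⟩ := ih (A'.length + B.length)
          (by simp at hn; omega) A' B rfl
        refine ⟨A1, A2 ++ y :: C, B1, B2, by simp [e1], e2, h1, ?_⟩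
        intro P S hP hS h
        exact step_left hP hA hC hB (h2 P S hP hS h)
      · obtain ⟨C, B', rfl⟩ := List.append_of_mem hy
        rw [List.count_append, List.count_cons_self] at hc
        have hA : y ∉ A := by rw [← List.count_eq_zero]; omega
        have hC : y ∉ C := by rw [← List.count_eq_zero]; omega
        have hB : y ∉ B' := by rw [← List.count_eq_zero]; omega
        obtain ⟨A1, A2, B1, B2, e1, e2, h1, h2⟩ := ih (A.length + B'.length)
          (by simp at hn; omega) A B' rfl
        refine ⟨A1, A2, B1, C ++ y :: B2, e1, by simp [e2], h1, ?_⟩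
        intro P S hP hS h
        exact step_right hS hA hC hB (h2 P S hP hS h)

def emb (n : ℕ) : Fin n → ℕ ⊕ ℕ :=
  fun i => if 2 * i.val < n then Sum.inl i.val else Sum.inr (n - 1 - i.val)

lemma emb_inj (n : ℕ) : Function.Injective (emb n) := by
  intro a b h
  unfold emb at h
  apply Fin.ext
  split_ifs at h <;> simp at h <;> omega

lemma word_upper {α : Type} {n : ℕ} (ω : ℕ ⊕ ℕ → α) {u m v : List α}
    (h : List.ofFn (ω ∘ emb n) = u ++ m ++ v) (hu : 2 * u.length ≤ n) (hv : 2 * v.length ≤ n) :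
    IsPre u (ω ∘ Sum.inl) ∧ IsPre v.reverse (ω ∘ Sum.inr) := by
  have hl : n = u.length + m.length + v.length := by
    have := congrArg List.length h
    simpa [add_assoc] using this
  have hget : ∀ i (hi : i < n), (ω (emb n ⟨i, hi⟩)) = (u ++ m ++ v)[i]'(by simp; omega) := by
    intro i hi
    simp only [← h]
    simp
  constructor
  · intro i hi
    have := hget i (by omega)
    rw [List.getElem_append_left (by simp; omega), List.getElem_append_left hi] at this
    rw [← this]
    simp only [emb, Function.comp]
    rw [if_pos (by omega)]
  · intro i hi
    simp at hi
    have := hget (n - 1 - i) (by omega)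
    rw [List.getElem_append_right (by simp; omega)] at this
    rw [List.getElem_reverse]
    have e : ω (emb n ⟨n - 1 - i, by omega⟩) = (ω ∘ Sum.inr) i := by
      simp only [emb, Function.comp]
      rw [if_neg (by omega)]
      congr 2; omega
    rw [← e, this]
    congr 1
    simp; omega

lemma word_lower {α : Type} {n : ℕ} (ω : ℕ ⊕ ℕ → α) {u v : List α}
    (hu : IsPre u (ω ∘ Sum.inl)) (hv : IsPre v.reverse (ω ∘ Sum.inr))
    (hun : 2 * u.length < n) (hvn : 2 * v.length < n) :
    ∃ m : List α, m ≠ [] ∧ List.ofFn (ω ∘ emb n) = u ++ m ++ v := by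
  set W := List.ofFn (ω ∘ emb n) with hW
  have hl : W.length = n := by simp [hW]
  have e1 : W.take u.length = u := by
    apply List.ext_getElem
    · simp [hl]; omega
    · intro i h1 h2
      rw [List.getElem_take, hu i h2]
      simp only [hW, List.getElem_ofFn, emb, Function.comp]
      rw [if_pos (by omega)]
  have e2 : W.drop (n - v.length) = v := by
    apply List.ext_getElem
    · simp [hl]; omega
    · intro i h1 h2
      have h3 := hv (v.length - 1 - i) (by simp; omega)
      rw [List.getElem_reverse] at h3
      have h4 : v[i] = (ω ∘ Sum.inr) (v.length - 1 - i) := by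
        rw [← h3]; congr 1; omega
      rw [List.getElem_drop, h4]
      simp only [hW, List.getElem_ofFn, emb, Function.comp]
      rw [if_neg (by omega)]
      congr 2; omega
  refine ⟨(W.take (n - v.length)).drop u.length, ?_, ?_⟩
  · intro h
    have := congrArg List.length h
    simp [hl] at this
    omega
  · have h1 := List.take_append_drop (n - v.length) W
    have h2 := List.take_append_drop u.length (W.take (n - v.length))
    rw [List.take_take, min_eq_left (by omega), e1] at h2
    rw [e2] at h1
    rw [h2, h1]

lemma len_flat {Γ : Type*} [DecidableEq Γ] {α : Type} (φ : Γ → List α) (A : List Γ) :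
    (A.map φ).flatten.length = ∑ y ∈ A.toFinset, A.count y * (φ y).length := by
  rw [List.length_flatten, List.map_map, Finset.sum_list_map_count]
  simp

def Prof {Γ : Type*} [DecidableEq Γ] (A B : List Γ) (q n : ℕ)
    (l : {y // y ∈ (A ++ B).toFinset} → ℕ) : Set (Fin n → Fin q) :=
  {W | ∃ (φ : Γ → List (Fin q)) (m : List (Fin q)), (∀ y : {y // y ∈ (A ++ B).toFinset},
    (φ y).length = l y) ∧ List.ofFn W = (A.map φ).flatten ++ m ++ (B.map φ).flatten}

lemma prof_card {Γ : Type*} [DecidableEq Γ] (A B : List Γ)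
    (h2 : ∀ y ∈ A ++ B, 2 ≤ (A ++ B).count y) (q n : ℕ) (hq : 0 < q)
    (l : {y // y ∈ (A ++ B).toFinset} → ℕ) :
    Nat.card (Prof A B q n l) * q ^ (∑ y, l y) ≤ q ^ n := by
  classical
  set T := ∑ y : {y // y ∈ (A ++ B).toFinset}, (A ++ B).count y.1 * l y with hT
  have hT2 : 2 * ∑ y, l y ≤ T := by
    rw [Finset.mul_sum]
    apply Finset.sum_le_sum
    intro y _
    exact Nat.mul_le_mul_right _ (h2 y.1 (List.mem_toFinset.1 y.2))
  rcases isEmpty_or_nonempty (Prof A B q n l) with he | ⟨⟨W0, hW0⟩⟩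
  · simp
  have hlen : ∀ (W : Fin n → Fin q) (φ : Γ → List (Fin q)) (m : List (Fin q)),
      (∀ y : {y // y ∈ (A ++ B).toFinset}, (φ y).length = l y) →
      List.ofFn W = (A.map φ).flatten ++ m ++ (B.map φ).flatten → T + m.length = n := by
    intro W φ m h1 h3
    have h4 := len_flat φ (A ++ B)
    rw [← Finset.sum_coe_sort] at h4
    simp only [h1] at h4
    rw [← hT] at h4
    have h5 := congrArg List.length h3
    simp only [List.length_ofFn, List.length_append] at h5
    rw [List.map_append, List.flatten_append, List.length_append] at h4
    omega
  have hTn : T ≤ n := by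
    obtain ⟨φ, m, h1, h3⟩ := hW0
    have := hlen W0 φ m h1 h3
    omega
  have hch : ∀ W : Prof A B q n l, ∃ (φ : Γ → List (Fin q)) (m : List (Fin q)),
      (∀ y : {y // y ∈ (A ++ B).toFinset}, (φ y).length = l y) ∧
      List.ofFn W.1 = (A.map φ).flatten ++ m ++ (B.map φ).flatten := fun W => W.2
  choose φ m h1 h3 using hch
  have hcard : Nat.card (Prof A B q n l) ≤
      Nat.card (((y : {y // y ∈ (A ++ B).toFinset}) → List.Vector (Fin q) (l y)) ×
        List.Vector (Fin q) (n - T)) := by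
    refine Nat.card_le_card_of_injective (fun W =>
      (fun y => ⟨φ W y, h1 W y⟩, ⟨m W, by have := hlen W.1 _ _ (h1 W) (h3 W); omega⟩)) ?_
    intro W W' hWW
    have e1 := congrArg Prod.fst hWW
    have e2 := congrArg Prod.snd hWW
    have e2' : m W = m W' := congrArg Subtype.val e2
    have e1' : ∀ y ∈ A ++ B, φ W y = φ W' y := by
      intro y hy
      exact congrArg Subtype.val (congrFun e1 ⟨y, List.mem_toFinset.2 hy⟩)
    apply Subtype.ext
    apply List.ofFn_injective
    rw [h3 W, h3 W', e2', map_congr' (fun y hy => e1' y (List.mem_append_left _ hy)),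
      map_congr' (fun y hy => e1' y (List.mem_append_right _ hy))]
  have hcard2 : Nat.card (((y : {y // y ∈ (A ++ B).toFinset}) → List.Vector (Fin q) (l y)) ×
        List.Vector (Fin q) (n - T)) = q ^ (∑ y, l y) * q ^ (n - T) := by
    rw [Nat.card_eq_fintype_card, Fintype.card_prod, Fintype.card_pi]
    simp only [card_vector, Fintype.card_fin]
    rw [Finset.prod_pow_eq_pow_sum]
  rw [hcard2] at hcard
  calc _ ≤ q ^ (∑ y, l y) * q ^ (n - T) * q ^ (∑ y, l y) := Nat.mul_le_mul_right _ hcard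
    _ = q ^ ((∑ y, l y) + (n - T) + ∑ y, l y) := by rw [← pow_add, ← pow_add]
    _ ≤ q ^ n := Nat.pow_le_pow_right hq (by omega)

def Bad {Γ : Type*} [DecidableEq Γ] (A B : List Γ) (q n K : ℕ) : Set (Fin n → Fin q) :=
  {W | ∃ (φ : Γ → List (Fin q)) (m : List (Fin q)), K ≤ ∑ y ∈ (A ++ B).toFinset, (φ y).length ∧
    List.ofFn W = (A.map φ).flatten ++ m ++ (B.map φ).flatten}

lemma geom34 (N : ℕ) : ∑ i ∈ Finset.range N, (3 / 4 : ℝ) ^ i ≤ 4 := by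
  rw [geom_sum_eq (by norm_num)]
  have : (0 : ℝ) ≤ (3 / 4) ^ N := by positivity
  rw [div_le_iff_of_neg (by norm_num)]
  linarith

lemma bad_card {Γ : Type*} [DecidableEq Γ] (A B : List Γ)
    (h2 : ∀ y ∈ A ++ B, 2 ≤ (A ++ B).count y) (q n K : ℕ) (hq : 2 ≤ q) :
    (Nat.card (Bad A B q n K) : ℝ) / (q : ℝ) ^ n ≤
      4 ^ Fintype.card {y // y ∈ (A ++ B).toFinset} * (3 / 4 : ℝ) ^ K := by
  classical
  set F : Finset ({y // y ∈ (A ++ B).toFinset} → ℕ) :=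
    (Fintype.piFinset (fun _ => Finset.range (n + 1))).filter (fun l => K ≤ ∑ y, l y) with hF
  have hqn : (0 : ℝ) < (q : ℝ) ^ n := by positivity
  have hsub : (Bad A B q n K).toFinset ⊆ F.biUnion (fun l => (Prof A B q n l).toFinset) := by
    intro W hW
    simp only [Set.mem_toFinset] at hW
    obtain ⟨φ, m, hK, he⟩ := hW
    simp only [Finset.mem_biUnion, Set.mem_toFinset]
    refine ⟨fun y => (φ y).length, ?_, φ, m, fun _ => rfl, he⟩
    simp only [hF, Finset.mem_filter, Fintype.mem_piFinset, Finset.mem_range]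
    constructor
    · rintro ⟨y, hy⟩
      have h5 := congrArg List.length he
      have h4 := len_flat φ (A ++ B)
      simp only [List.length_ofFn, List.length_append] at h5
      rw [List.map_append, List.flatten_append, List.length_append] at h4
      have h6 : (A ++ B).count y * (φ y).length ≤
          ∑ y ∈ (A ++ B).toFinset, (A ++ B).count y * (φ y).length :=
        Finset.single_le_sum (f := fun y => (A ++ B).count y * (φ y).length)
          (fun _ _ => Nat.zero_le _) hy
      have h7 := h2 y (List.mem_toFinset.1 hy)
      have h8 : 2 * (φ y).length ≤ (A ++ B).count y * (φ y).length := Nat.mul_le_mul_right _ h7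
      simp only
      omega
    · rw [Finset.sum_coe_sort (A ++ B).toFinset (fun y => (φ y).length)]
      exact hK
  have hone : ∀ l ∈ F, (((Prof A B q n l).toFinset.card : ℕ) : ℝ) / (q : ℝ) ^ n ≤
      (3 / 4 : ℝ) ^ K * ∏ y, (3 / 4 : ℝ) ^ (l y) := by
    intro l hl
    have hK : K ≤ ∑ y, l y := (Finset.mem_filter.1 hl).2
    have h := prof_card A B h2 q n (by omega) l
    rw [Nat.card_eq_fintype_card, ← Set.toFinset_card] at h
    have h' : (((Prof A B q n l).toFinset.card : ℕ) : ℝ) * (q : ℝ) ^ (∑ y, l y) ≤ (q : ℝ) ^ n := by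
      exact_mod_cast h
    set s := ∑ y, l y with hs
    have hqs : (0 : ℝ) < (q : ℝ) ^ s := by positivity
    have hq2 : (2 : ℝ) ≤ q := by exact_mod_cast hq
    calc (((Prof A B q n l).toFinset.card : ℕ) : ℝ) / (q : ℝ) ^ n ≤ ((q : ℝ) ^ s)⁻¹ := by
          rw [div_le_iff₀ hqn, ← div_eq_inv_mul, le_div_iff₀ hqs]
          exact h'
      _ = ((q : ℝ)⁻¹) ^ s := by rw [inv_pow]
      _ ≤ ((3 / 4 : ℝ) * (3 / 4)) ^ s := by
          apply pow_le_pow_left₀ (by positivity)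
          calc (q : ℝ)⁻¹ ≤ 2⁻¹ := by gcongr
            _ ≤ _ := by norm_num
      _ = (3 / 4 : ℝ) ^ s * (3 / 4) ^ s := mul_pow _ _ _
      _ ≤ (3 / 4 : ℝ) ^ K * (3 / 4) ^ s := by
          gcongr ?_ * _
          exact pow_le_pow_of_le_one (by norm_num) (by norm_num) hK
      _ = _ := by rw [Finset.prod_pow_eq_pow_sum]
  calc (Nat.card (Bad A B q n K) : ℝ) / (q : ℝ) ^ n
      = (((Bad A B q n K).toFinset.card : ℕ) : ℝ) / (q : ℝ) ^ n := by
        rw [Nat.card_eq_fintype_card, Set.toFinset_card]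
    _ ≤ (∑ l ∈ F, (((Prof A B q n l).toFinset.card : ℕ) : ℝ)) / (q : ℝ) ^ n := by
        gcongr
        have := (Finset.card_le_card hsub).trans Finset.card_biUnion_le
        exact_mod_cast this
    _ = ∑ l ∈ F, (((Prof A B q n l).toFinset.card : ℕ) : ℝ) / (q : ℝ) ^ n := Finset.sum_div _ _ _
    _ ≤ ∑ l ∈ F, (3 / 4 : ℝ) ^ K * ∏ y, (3 / 4 : ℝ) ^ (l y) := Finset.sum_le_sum hone
    _ = (3 / 4 : ℝ) ^ K * ∑ l ∈ F, ∏ y, (3 / 4 : ℝ) ^ (l y) := (Finset.mul_sum _ _ _).symm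
    _ ≤ (3 / 4 : ℝ) ^ K * ∑ l ∈ Fintype.piFinset
          (fun _ : {y // y ∈ (A ++ B).toFinset} => Finset.range (n + 1)),
          ∏ y, (3 / 4 : ℝ) ^ (l y) := by
        gcongr
        exact Finset.filter_subset _ _
    _ = (3 / 4 : ℝ) ^ K * ∏ _y : {y // y ∈ (A ++ B).toFinset},
          ∑ i ∈ Finset.range (n + 1), (3 / 4 : ℝ) ^ i := by
        rw [Finset.prod_univ_sum]
    _ ≤ (3 / 4 : ℝ) ^ K * ∏ _y : {y // y ∈ (A ++ B).toFinset}, (4 : ℝ) := by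
        gcongr
        exact geom34 _
    _ = _ := by
        rw [Finset.prod_const, Finset.card_univ, mul_comm]

lemma exists_ofFn {α : Type} {n : ℕ} (l : List α) (h : l.length = n) :
    ∃ W : Fin n → α, List.ofFn W = l := by
  subst h
  exact ⟨l.get, List.ofFn_get l⟩

lemma inst_of_form {Γ : Type*} [DecidableEq Γ] {α : Type} {A B : List Γ} {x : Γ}
    (hA : x ∉ A) (hB : x ∉ B) (φ : Γ → List α) (hφ : ∀ y ∈ A ++ B, φ y ≠ []) {m : List α}
    (hm : m ≠ []) :
    IsInstance (A ++ x :: B) ((A.map φ).flatten ++ m ++ (B.map φ).flatten) := by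
  refine ⟨fun z => if z = x then m else φ z, ?_, ?_⟩
  · intro z hz
    by_cases hzx : z = x
    · simpa [hzx] using hm
    · simp only [hzx, if_false]
      apply hφ
      simp [hzx] at hz ⊢
      exact hz
  · have hA1 : (A.map (fun z => if z = x then m else φ z)).flatten = (A.map φ).flatten := by
      apply map_congr'
      intro z hz
      have : z ≠ x := by rintro rfl; exact hA hz
      simp [this]
    have hB1 : (B.map (fun z => if z = x then m else φ z)).flatten = (B.map φ).flatten := by
      apply map_congr'
      intro z hz
      have : z ≠ x := by rintro rfl; exact hB hz
      simp [this]
    rw [List.map_append, List.flatten_append, List.map_cons, List.flatten_cons, hA1, hB1,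
      List.append_assoc]
    simp

lemma flat_single {Γ : Type*} {α : Type} (f : Γ → α) (A : List Γ) :
    (A.map (fun y => [f y])).flatten = A.map f := by
  induction A with
  | nil => rfl
  | cons a A ih => simp [ih]

lemma lower_count {Γ : Type*} [DecidableEq Γ] {A B : List Γ} {x : Γ}
    (hA : x ∉ A) (hB : x ∉ B) (q n : ℕ) (hq : 0 < q) (hn : (A ++ x :: B).length ≤ n) :
    q ^ n ≤ Nat.card {W : Fin n → Fin q // IsInstance (A ++ x :: B) (List.ofFn W)} *
      q ^ recurCount (A ++ x :: B) := by
  classical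
  have hlen : (A ++ x :: B).length = A.length + B.length + 1 := by simp; omega
  have : NeZero q := ⟨by omega⟩
  let ext : ({y // y ∈ (A ++ B).toFinset} → Fin q) → Γ → Fin q :=
    fun f y => if h : y ∈ (A ++ B).toFinset then f ⟨y, h⟩ else 0
  have hex : ∀ p : ({y // y ∈ (A ++ B).toFinset} → Fin q) ×
      (Fin (n - (A.length + B.length)) → Fin q), ∃ W : Fin n → Fin q,
      List.ofFn W = A.map (ext p.1) ++ List.ofFn p.2 ++ B.map (ext p.1) := by
    intro p
    apply exists_ofFn
    simp; omega
  choose W hW using hex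
  have hinj : Nat.card (({y // y ∈ (A ++ B).toFinset} → Fin q) ×
      (Fin (n - (A.length + B.length)) → Fin q)) ≤
      Nat.card {W : Fin n → Fin q // IsInstance (A ++ x :: B) (List.ofFn W)} := by
    refine Nat.card_le_card_of_injective (fun p => ⟨W p, ?_⟩) ?_
    · rw [hW p, ← flat_single (ext p.1) A, ← flat_single (ext p.1) B]
      apply inst_of_form hA hB
      · simp
      · intro h
        have := congrArg List.length h
        simp at this
        omega
    · intro p p' h
      have h1 : W p = W p' := congrArg Subtype.val h
      have h2 := hW p
      rw [h1, hW p'] at h2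
      have h3 := List.append_inj' h2 (by simp)
      have h4 := List.append_inj h3.1 (by simp)
      have h5 : p'.2 = p.2 := List.ofFn_injective h4.2
      have h6 : p'.1 = p.1 := by
        funext ⟨y, hy⟩
        have h7 : ext p'.1 y = ext p.1 y := by
          rcases List.mem_append.1 (List.mem_toFinset.1 hy) with hy' | hy'
          · exact List.map_inj_left.1 h4.1 y hy'
          · exact List.map_inj_left.1 h3.2 y hy'
        simp only [ext, hy, dif_pos] at h7
        exact h7
      exact (Prod.ext h6 h5).symm
  have hcard : Nat.card (({y // y ∈ (A ++ B).toFinset} → Fin q) ×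
      (Fin (n - (A.length + B.length)) → Fin q)) =
      q ^ (A ++ B).toFinset.card * q ^ (n - (A.length + B.length)) := by
    rw [Nat.card_eq_fintype_card]
    simp
  have hd : (A ++ x :: B).dedup.length = (A ++ B).toFinset.card + 1 := by
    rw [← List.card_toFinset]
    have : (A ++ x :: B).toFinset = insert x (A ++ B).toFinset := by
      ext z; simp
    rw [this, Finset.card_insert_of_notMem]
    simp [hA, hB]
  have hle : (A ++ B).toFinset.card ≤ A.length + B.length := by
    have := List.toFinset_card_le (A ++ B)
    simpa using this
  have hr : recurCount (A ++ x :: B) = A.length + B.length - (A ++ B).toFinset.card := by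
    unfold recurCount
    rw [hd, hlen]; omega
  rw [hcard] at hinj
  calc q ^ n = q ^ (A ++ B).toFinset.card * q ^ (n - (A.length + B.length)) *
        q ^ recurCount (A ++ x :: B) := by
        rw [← pow_add, ← pow_add]; congr 1; omega
    _ ≤ _ := Nat.mul_le_mul_right _ hinj

def InstSet {Γ : Type*} (V : List Γ) (q n : ℕ) : Set (Fin n → Fin q) :=
  {W | IsInstance V (List.ofFn W)}

lemma instProb_eq {Γ : Type*} (V : List Γ) (q n : ℕ) [NeZero q] :
    instProb V q n = (mu q).real {ω | ω ∘ emb n ∈ InstSet V q n} := by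
  rw [mu_comp (emb n) (emb_inj n)]
  simp only [Fintype.card_fin]
  rfl

lemma instProb_lower {Γ : Type*} [DecidableEq Γ] {A B : List Γ} {x : Γ}
    (hA : x ∉ A) (hB : x ∉ B) (q n : ℕ) (hq : 0 < q) (hn : (A ++ x :: B).length ≤ n) :
    ((q : ℝ) ^ recurCount (A ++ x :: B))⁻¹ ≤ instProb (A ++ x :: B) q n := by
  have h := lower_count hA hB q n hq hn
  unfold instProb
  rw [le_div_iff₀ (by positivity), ← div_eq_inv_mul, div_le_iff₀ (by positivity)]
  exact_mod_cast h

def EvSet {Γ : Type*} (A B : List Γ) (q : ℕ) : Set (ℕ ⊕ ℕ → Fin q) :=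
  {ω | Ev A B (ω ∘ Sum.inl) (ω ∘ Sum.inr)}

lemma upper_incl {Γ : Type*} [DecidableEq Γ] {A D B : List Γ} {q n K : ℕ}
    (hn : 2 * ((A.length + B.length) * K) ≤ n) :
    {ω : ℕ ⊕ ℕ → Fin q | ω ∘ emb n ∈ InstSet (A ++ D ++ B) q n} ⊆
      EvSet A B q ∪ {ω | ω ∘ emb n ∈ Bad A B q n K} := by
  rintro ω ⟨φ, h1, h2⟩
  rw [List.map_append, List.map_append, List.flatten_append, List.flatten_append] at h2
  by_cases hK : K ≤ ∑ y ∈ (A ++ B).toFinset, (φ y).length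
  · right
    exact ⟨φ, _, hK, h2⟩
  · left
    have hy : ∀ y ∈ A ++ B, (φ y).length ≤ K := by
      intro y hy
      have := Finset.single_le_sum (f := fun y => (φ y).length)
          (fun _ _ => Nat.zero_le _) (List.mem_toFinset.2 hy)
      omega
    have hb : ∀ C : List Γ, (∀ y ∈ C, y ∈ A ++ B) → (C.map φ).flatten.length ≤ C.length * K := by
      intro C hC
      induction C with
      | nil => simp
      | cons c C ih =>
        have e1 := ih (fun y hy => hC y (List.mem_cons_of_mem _ hy))
        have e2 := hy c (hC c List.mem_cons_self)
        rw [List.map_cons, List.flatten_cons, List.length_append, List.length_cons, Nat.add_mul]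
        omega
    have hbA := hb A (fun y hy => List.mem_append_left _ hy)
    have hbB := hb B (fun y hy => List.mem_append_right _ hy)
    rw [Nat.add_mul] at hn
    have := word_upper ω h2 (by omega) (by omega)
    refine ⟨φ, ?_, this.1, this.2⟩
    intro y hy
    apply h1
    simp at hy ⊢
    tauto

lemma lower_incl {Γ : Type*} [DecidableEq Γ] {A B : List Γ} {x : Γ}
    (hA : x ∉ A) (hB : x ∉ B) (q : ℕ) :
    EvSet A B q ⊆ ⋃ N : ℕ, ⋂ n ≥ N, {ω | ω ∘ emb n ∈ InstSet (A ++ x :: B) q n} := by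
  rintro ω ⟨φ, h1, h2, h3⟩
  simp only [Set.mem_iUnion, Set.mem_iInter]
  refine ⟨2 * ((A.map φ).flatten.length + (B.map φ).flatten.length) + 1, ?_⟩
  intro n hn
  obtain ⟨m, hm, he⟩ := word_lower (n := n) ω h2 h3 (by omega) (by omega)
  show IsInstance _ _
  rw [he]
  exact inst_of_form hA hB φ h1 hm

lemma tendsto_main {Γ : Type*} [DecidableEq Γ] {A B : List Γ} {x : Γ}
    (hA : x ∉ A) (hB : x ∉ B) (q : ℕ) (hq : 2 ≤ q) :
    ∃ L : ℝ, Tendsto (fun n => instProb (A ++ x :: B) q n) atTop (nhds L) := by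
  have : NeZero q := ⟨by omega⟩
  refine ⟨(mu q).real (EvSet A B q), ?_⟩
  simp only [instProb_eq]
  set E : ℕ → Set (ℕ ⊕ ℕ → Fin q) := fun n => {ω | ω ∘ emb n ∈ InstSet (A ++ x :: B) q n} with hE
  rw [tendsto_order]
  constructor
  · intro a ha
    have hmono : Monotone (fun N : ℕ => ⋂ n ≥ N, E n) := by
      intro N M hNM
      exact Set.biInter_mono (fun n hn => le_trans hNM hn) (fun _ _ => le_rfl)
    have ht := tendsto_measure_iUnion_atTop (μ := mu q) hmono
    have ht' : Tendsto (fun N => (mu q).real (⋂ n ≥ N, E n)) atTop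
        (nhds ((mu q).real (⋃ N : ℕ, ⋂ n ≥ N, E n))) :=
      (ENNReal.tendsto_toReal (measure_ne_top _ _)).comp ht
    have hlt : a < (mu q).real (⋃ N : ℕ, ⋂ n ≥ N, E n) :=
      lt_of_lt_of_le ha (measureReal_mono (lower_incl hA hB q))
    filter_upwards [ht'.eventually_const_lt hlt] with n hn
    refine lt_of_lt_of_le hn (measureReal_mono ?_)
    exact Set.iInter₂_subset n le_rfl
  · intro a ha
    obtain ⟨A1, A2, B1, B2, e1, e2, h2, hcore⟩ :=
      exists_core (α := Fin q) _ A B rfl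
    have hle : (mu q).real (EvSet A1 B1 q) ≤ (mu q).real (EvSet A B q) := by
      have hae : EvSet A1 B1 q ≤ᵐ[mu q] EvSet A B q := by
        filter_upwards [ae_occ (q := q) Sum.inl Sum.inl_injective,
          ae_occ (q := q) Sum.inr Sum.inr_injective] with ω o1 o2 h
        exact hcore _ _ o1 o2 h
      exact ENNReal.toReal_mono (measure_ne_top _ _) (measure_mono_ae hae)
    set d := Fintype.card {y // y ∈ (A1 ++ B1).toFinset} with hd
    have hlim : Tendsto (fun K : ℕ => (4 : ℝ) ^ d * (3 / 4 : ℝ) ^ K) atTop (nhds 0) := by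
      have := (tendsto_pow_atTop_nhds_zero_of_lt_one (r := (3 / 4 : ℝ)) (by norm_num)
        (by norm_num)).const_mul ((4 : ℝ) ^ d)
      simpa using this
    obtain ⟨K, hK⟩ := (hlim.eventually_lt_const (sub_pos.2 ha)).exists
    filter_upwards [eventually_ge_atTop (2 * ((A1.length + B1.length) * K))] with n hn
    have hV : A ++ x :: B = A1 ++ (A2 ++ x :: B2) ++ B1 := by
      rw [e1, e2]; simp
    have hs : E n ⊆ EvSet A1 B1 q ∪ {ω | ω ∘ emb n ∈ Bad A1 B1 q n K} := by
      simp only [hE]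
      rw [hV]
      exact upper_incl hn
    have h3 := (measureReal_mono (μ := mu q) hs).trans (measureReal_union_le _ _)
    have h4 := bad_card A1 B1 h2 q n K hq
    have h5 := mu_comp (emb n) (emb_inj n) (Bad A1 B1 q n K)
    rw [Fintype.card_fin] at h5
    rw [← h5] at h4
    refine lt_of_le_of_lt h3 ?_
    linarith

end ZW

theorem stmt12 {Γ : Type*} [DecidableEq Γ] (V : List Γ) (hV : V ≠ [])
    (hnd : ∃ x ∈ V, V.count x = 1) (q : ℕ) (hq : 0 < q) :
    ∃ L : ℝ, Tendsto (fun n => instProb V q n) atTop (nhds L) ∧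
      ((q : ℝ) ^ recurCount V)⁻¹ ≤ L ∧ 0 < ((q : ℝ) ^ recurCount V)⁻¹ := by
  obtain ⟨x, hx, hc⟩ := hnd
  obtain ⟨A, B, rfl⟩ := List.append_of_mem hx
  rw [List.count_append, List.count_cons_self] at hc
  have hA : x ∉ A := by rw [← List.count_eq_zero]; omega
  have hB : x ∉ B := by rw [← List.count_eq_zero]; omega
  have hpos : 0 < ((q : ℝ) ^ recurCount (A ++ x :: B))⁻¹ := by positivity
  have hev : ∀ᶠ n in atTop, ((q : ℝ) ^ recurCount (A ++ x :: B))⁻¹ ≤ instProb (A ++ x :: B) q n := by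
    filter_upwards [eventually_ge_atTop (A ++ x :: B).length] with n hn
    exact ZW.instProb_lower hA hB q n hq hn
  have hex : ∃ L : ℝ, Tendsto (fun n => instProb (A ++ x :: B) q n) atTop (nhds L) := by
    by_cases h2 : 2 ≤ q
    · exact ZW.tendsto_main hA hB q h2
    · have h1 : q = 1 := by omega
      subst h1
      refine ⟨1, tendsto_const_nhds.congr' ?_⟩
      filter_upwards [hev] with n hn
      refine le_antisymm (by simpa using hn) ?_
      rw [ZW.instProb_eq]
      exact MeasureTheory.measureReal_le_one
  obtain ⟨L, hL⟩ := hex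
  exact ⟨L, hL, ge_of_tendsto hL hev, hpos⟩
end

section
/- Let V be a nonempty word that is not doubled (i.e., some letter occurs exactly once in V) and let q be a positive integer. Then the expected instance densities δ_n(V,q) converge as n → ∞ to I(V,q) = lim_{n→∞} I_n(V,q). -/
open Filter

namespace Stmt13

noncomputable def Ex (q n : ℕ) (f : List (Fin q) → ℝ) : ℝ :=
  (∑ W : Fin n → Fin q, f (List.ofFn W)) / (q : ℝ) ^ n

open Classical in
noncomputable def ind (p : Prop) : ℝ := if p then 1 else 0

noncomputable def Pr (q n : ℕ) (E : List (Fin q) → Prop) : ℝ := Ex q n (fun w => ind (E w))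

lemma ind_nonneg (p : Prop) : 0 ≤ ind p := by unfold ind; split_ifs <;> norm_num
lemma ind_le_one (p : Prop) : ind p ≤ 1 := by unfold ind; split_ifs <;> norm_num

variable {q : ℕ}

lemma Ex_mono {n : ℕ} {f g : List (Fin q) → ℝ} (h : ∀ w, w.length = n → f w ≤ g w) :
    Ex q n f ≤ Ex q n g := by
  unfold Ex
  have : ∑ W : Fin n → Fin q, f (List.ofFn W) ≤ ∑ W : Fin n → Fin q, g (List.ofFn W) :=
    Finset.sum_le_sum (fun W _ => h _ (by simp))
  gcongr

lemma Ex_congr {n : ℕ} {f g : List (Fin q) → ℝ} (h : ∀ w, w.length = n → f w = g w) :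
    Ex q n f = Ex q n g :=
  le_antisymm (Ex_mono fun w hw => (h w hw).le) (Ex_mono fun w hw => (h w hw).ge)

lemma Ex_add {n : ℕ} (f g : List (Fin q) → ℝ) :
    Ex q n (fun w => f w + g w) = Ex q n f + Ex q n g := by
  unfold Ex; rw [Finset.sum_add_distrib, add_div]

lemma Ex_sum {n : ℕ} {ι : Type*} (s : Finset ι) (f : ι → List (Fin q) → ℝ) :
    Ex q n (fun w => ∑ i ∈ s, f i w) = ∑ i ∈ s, Ex q n (f i) := by
  unfold Ex; rw [Finset.sum_comm, Finset.sum_div]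

lemma Ex_mul_const {n : ℕ} (f : List (Fin q) → ℝ) (c : ℝ) :
    Ex q n (fun w => f w * c) = Ex q n f * c := by
  unfold Ex; rw [← Finset.sum_mul]; ring

lemma Ex_const (hq : 0 < q) {n : ℕ} (c : ℝ) : Ex q n (fun _ => c) = c := by
  unfold Ex
  have : (q : ℝ) ^ n ≠ 0 := by positivity
  simp
  field_simp

lemma Ex_append (a b : ℕ) (f : List (Fin q) → ℝ) :
    Ex q (a + b) f = Ex q a (fun u => Ex q b (fun v => f (u ++ v))) := by
  unfold Ex
  have h : ∑ W : Fin (a + b) → Fin q, f (List.ofFn W) =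
      ∑ u : Fin a → Fin q, ∑ v : Fin b → Fin q, f (List.ofFn u ++ List.ofFn v) := by
    rw [← Fintype.sum_prod_type', ← (Fin.appendEquiv a b).sum_comp]
    simp [Fin.appendEquiv, List.ofFn_fin_append]
  rw [h, ← Finset.sum_div, div_div, pow_add, mul_comm ((q : ℝ) ^ a)]

lemma Ex_reverse (n : ℕ) (f : List (Fin q) → ℝ) :
    Ex q n (fun w => f w.reverse) = Ex q n f := by
  unfold Ex
  congr 1
  refine Fintype.sum_equiv (Equiv.arrowCongr Fin.revPerm (Equiv.refl _)) _ _ ?_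
  intro W
  refine congrArg f ?_
  apply List.ext_getElem
  · simp
  · intro i h1 h2
    simp at h1
    simp [List.getElem_reverse]
    congr 1
    apply Fin.ext
    simp only [Fin.val_rev]
    omega

lemma Pr_nonneg {n : ℕ} (E : List (Fin q) → Prop) : 0 ≤ Pr q n E := by
  unfold Pr Ex
  have := fun w => ind_nonneg (E w)
  exact div_nonneg (Finset.sum_nonneg fun _ _ => this _) (by positivity)

lemma Pr_mono {n : ℕ} {E F : List (Fin q) → Prop} (h : ∀ w, w.length = n → E w → F w) :
    Pr q n E ≤ Pr q n F := by
  refine Ex_mono fun w hw => ?_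
  have := h w hw
  unfold ind
  split_ifs <;> first | tauto | norm_num

lemma Pr_congr {n : ℕ} {E F : List (Fin q) → Prop} (h : ∀ w, w.length = n → (E w ↔ F w)) :
    Pr q n E = Pr q n F :=
  le_antisymm (Pr_mono fun w hw => (h w hw).1) (Pr_mono fun w hw => (h w hw).2)

lemma Pr_union {n : ℕ} {E F G : List (Fin q) → Prop}
    (h : ∀ w, w.length = n → E w → F w ∨ G w) :
    Pr q n E ≤ Pr q n F + Pr q n G := by
  unfold Pr
  rw [← Ex_add]
  refine Ex_mono fun w hw => ?_
  have := h w hw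
  unfold ind
  split_ifs <;> first | tauto | norm_num

lemma Pr_append (a b : ℕ) (E : List (Fin q) → Prop) :
    Pr q (a + b) E = Ex q a (fun u => Pr q b (fun v => E (u ++ v))) := Ex_append _ _ _

lemma Pr_true (hq : 0 < q) {n : ℕ} {E : List (Fin q) → Prop} (h : ∀ w, w.length = n → E w) :
    Pr q n E = 1 := by
  rw [← Ex_const hq (n := n) 1]
  exact Ex_congr fun w hw => by simp [ind, h w hw]

lemma Pr_false {n : ℕ} {E : List (Fin q) → Prop} (h : ∀ w, w.length = n → ¬ E w) :
    Pr q n E = 0 := by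
  have : Pr q n E = Ex q n (fun _ => 0) := Ex_congr fun w hw => by simp [ind, h w hw]
  rw [this]; simp [Ex]

lemma Pr_const_and (n : ℕ) (p : Prop) (E : List (Fin q) → Prop) :
    Pr q n (fun w => p ∧ E w) = ind p * Pr q n E := by
  by_cases hp : p
  · simp [hp, ind]
  · rw [Pr_false (by tauto)]; simp [hp, ind]

lemma Pr_eq_card (n : ℕ) (E : List (Fin q) → Prop) :
    Pr q n E = (Nat.card {W : Fin n → Fin q // E (List.ofFn W)} : ℝ) / (q : ℝ) ^ n := by
  classical
  unfold Pr Ex ind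
  rw [Nat.card_eq_fintype_card, Fintype.card_subtype]
  simp

/-- The middle factor of a random word is a random word. -/
lemma Pr_factor (hq : 0 < q) (i l n : ℕ) (h : i + l ≤ n) (E : List (Fin q) → Prop) :
    Pr q n (fun w => E ((w.drop i).take l)) = Pr q l E := by
  obtain ⟨r, rfl⟩ := Nat.exists_eq_add_of_le h
  rw [add_assoc, Pr_append]
  have : ∀ u : List (Fin q), u.length = i →
      Pr q (l + r) (fun v => E (((u ++ v).drop i).take l)) = Pr q l E := by
    intro u hu
    rw [Pr_append]
    unfold Pr
    refine Ex_congr fun v hv => ?_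
    subst hu hv
    simp [Ex_const hq]
  rw [Ex_congr this, Ex_const hq]

/-- The word `z` occurs in a long random word with probability tending to one. -/
lemma Pr_not_infix (hq : 0 < q) (z : List (Fin q)) (j : ℕ) :
    Pr q (j * z.length) (fun w => ¬ z <:+: w) ≤ (1 - 1 / (q : ℝ) ^ z.length) ^ j := by
  induction j with
  | zero => 
    simp only [pow_zero]
    rw [← Pr_true hq (n := 0 * z.length) (E := fun _ => True) (by simp)]
    exact Pr_mono (by simp)
  | succ j ih =>
    have hz : Pr q z.length (fun w => w ≠ z) = 1 - 1 / (q : ℝ) ^ z.length := by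
      have h1 : Pr q z.length (fun w => w ≠ z) + Pr q z.length (fun w => w = z) = 1 := by
        unfold Pr
        rw [← Ex_add, ← Ex_const hq (n := z.length) 1]
        refine Ex_congr fun w hw => ?_
        by_cases h : w = z <;> simp [h, ind]
      have h2 : Pr q z.length (fun w => w = z) = 1 / (q : ℝ) ^ z.length := by
        rw [Pr_eq_card]
        congr 1
        norm_cast
        rw [Nat.card_eq_one_iff_unique]
        refine ⟨⟨fun a b => ?_⟩, ⟨⟨z.get, by simp⟩⟩⟩
        exact Subtype.ext (List.ofFn_injective (a.2.trans b.2.symm))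
      linarith
    rw [Nat.succ_mul, add_comm, Pr_append, pow_succ']
    calc _ ≤ Ex q z.length (fun u => ind (u ≠ z) * (1 - 1 / (q : ℝ) ^ z.length) ^ j) := by
          refine Ex_mono fun u hu => ?_
          by_cases h : u = z
          · rw [Pr_false]
            · simp [h, ind]
            · intro w _ hw
              exact hw ⟨[], w, by simp [h]⟩
          · simp only [h, ind, ne_eq, not_false_eq_true, if_true, one_mul]
            refine le_trans (Pr_mono ?_) ih
            intro w _ hw h'
            exact hw (h'.trans (List.suffix_append u w).isInfix)
      _ = _ := by rw [Ex_mul_const]; rw [← hz]; rfl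

lemma exists_not_infix_le (hq : 0 < q) (z : List (Fin q)) (ε : ℝ) (hε : 0 < ε) :
    ∃ T, Pr q T (fun w => ¬ z <:+: w) ≤ ε := by
  have h1 : (1 : ℝ) ≤ (q : ℝ) ^ z.length := one_le_pow₀ (by exact_mod_cast hq)
  have h2 : 1 / (q : ℝ) ^ z.length ≤ 1 := by rw [div_le_one (by positivity)]; exact h1
  have h3 : 0 < 1 / (q : ℝ) ^ z.length := by positivity
  obtain ⟨j, hj⟩ := exists_pow_lt_of_lt_one hε (show 1 - 1 / (q : ℝ) ^ z.length < 1 by linarith)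
  exact ⟨_, (Pr_not_infix hq z j).trans hj.le⟩

section
set_option linter.unusedSectionVars false
variable {Γ : Type*} [DecidableEq Γ]

abbrev Others (V : List Γ) (x : Γ) : Type _ := {y // y ∈ V.toFinset.erase x}

def Short {β : Type*} (m : ℕ) (x : Γ) (V : List Γ) (W : List β) : Prop :=
  ∃ φ : Γ → List β, (∀ y ∈ V, φ y ≠ []) ∧ (∀ y ∈ V, y ≠ x → (φ y).length ≤ m) ∧
    W = (V.map φ).flatten

lemma Short.isInstance {β : Type*} {m : ℕ} {x : Γ} {V : List Γ} {W : List β}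
    (h : Short m x V W) : IsInstance V W := by
  obtain ⟨φ, h1, _, h3⟩ := h
  exact ⟨φ, h1, h3⟩

lemma length_image {β : Type*} (V : List Γ) (x : Γ) (hx : V.count x = 1) (φ : Γ → List β) :
    ((V.map φ).flatten).length =
      (φ x).length + ∑ y : Others V x, V.count (y : Γ) * (φ y).length := by
  have hxV : x ∈ V.toFinset := by
    rw [List.mem_toFinset, ← List.count_pos_iff]; omega
  rw [List.length_flatten, List.map_map, Finset.sum_list_map_count,
    ← Finset.add_sum_erase _ _ hxV, hx]
  simp only [Function.comp, smul_eq_mul, one_mul]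
  congr 1
  exact (Finset.sum_coe_sort (V.toFinset.erase x) (fun y => V.count y * (φ y).length)).symm

def HasLen (V : List Γ) (x : Γ) (l : Others V x → ℕ)
    (w : List (Fin q)) : Prop :=
  ∃ φ : Γ → List (Fin q), (∀ y : Others V x, (φ y).length = l y) ∧
    w = (V.map φ).flatten

lemma card_hasLen (hq : 0 < q) (V : List Γ) (x : Γ) (hx : V.count x = 1)
    (h2 : ∀ y ∈ V, y ≠ x → 2 ≤ V.count y) (l : Others V x → ℕ) (n : ℕ) :
    Nat.card {W : Fin n → Fin q // HasLen V x l (List.ofFn W)} * q ^ (∑ y, l y) ≤ q ^ n := by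
  classical
  set s := ∑ y : Others V x, V.count (y : Γ) * l y with hs
  have hlen : ∀ (W : Fin n → Fin q) (φ : Γ → List (Fin q)),
      (∀ y : Others V x, (φ y).length = l y) →
      List.ofFn W = (V.map φ).flatten → n = (φ x).length + s := by
    intro W φ h h'
    have := congrArg List.length h'
    rw [length_image V x hx] at this
    simp only [h, List.length_ofFn] at this
    exact this
  have h2s : 2 * ∑ y, l y ≤ s := by
    rw [hs, Finset.mul_sum]
    refine Finset.sum_le_sum fun y _ => ?_
    have hy := y.2
    rw [Finset.mem_erase, List.mem_toFinset] at hy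
    exact Nat.mul_le_mul_right _ (h2 y hy.2 hy.1)
  rcases isEmpty_or_nonempty {W : Fin n → Fin q // HasLen V x l (List.ofFn W)} with he | hne
  · simp
  obtain ⟨W₀, φ₀, h₀, h₀'⟩ := hne
  have hsn := hlen W₀ φ₀ h₀ h₀'
  choose Φ hΦ hΦ' using fun W : {W : Fin n → Fin q // HasLen V x l (List.ofFn W)} => W.2
  let F : {W : Fin n → Fin q // HasLen V x l (List.ofFn W)} →
      ((y : Others V x) → List.Vector (Fin q) (l y)) ×
        List.Vector (Fin q) (n - s) := fun W =>
    (fun y => ⟨Φ W y, hΦ W y⟩, ⟨Φ W x, by have := hlen W.1 (Φ W) (hΦ W) (hΦ' W); omega⟩)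
  have hF : Function.Injective F := by
    intro W W' h
    have hx' : Φ W x = Φ W' x := congrArg (fun p => p.2.1) h
    have hy' : ∀ y : Others V x, Φ W y = Φ W' y := fun y =>
      congrArg (fun p => (p.1 y).1) h
    apply Subtype.ext
    apply List.ofFn_injective
    rw [hΦ' W, hΦ' W']
    congr 1
    refine List.map_congr_left fun y hy => ?_
    by_cases hyx : y = x
    · rw [hyx, hx']
    · exact hy' ⟨y, by simp [hy, hyx]⟩
  have hc := Nat.card_le_card_of_injective F hF
  have hc2 : Nat.card (((y : Others V x) → List.Vector (Fin q) (l y)) ×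
        List.Vector (Fin q) (n - s)) = q ^ (∑ y, l y) * q ^ (n - s) := by
    rw [Nat.card_eq_fintype_card, Fintype.card_prod, Fintype.card_pi]
    simp [card_vector, Finset.prod_pow_eq_pow_sum]
  rw [hc2] at hc
  calc _ ≤ (q ^ (∑ y, l y) * q ^ (n - s)) * q ^ (∑ y, l y) := Nat.mul_le_mul_right _ hc
    _ = q ^ (2 * (∑ y, l y) + (n - s)) := by ring
    _ ≤ q ^ n := Nat.pow_le_pow_right hq (by omega)

lemma Pr_hasLen (hq : 0 < q) (V : List Γ) (x : Γ) (hx : V.count x = 1)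
    (h2 : ∀ y ∈ V, y ≠ x → 2 ≤ V.count y) (l : Others V x → ℕ) (n : ℕ) :
    Pr q n (HasLen V x l) ≤ ∏ y, (1 / (q : ℝ)) ^ (l y) := by
  rw [Pr_eq_card, Finset.prod_pow_eq_pow_sum, one_div, inv_pow, div_le_iff₀ (by positivity),
    inv_mul_eq_div, le_div_iff₀ (by positivity)]
  exact_mod_cast card_hasLen hq V x hx h2 l n

lemma Pr_biUnion {ι : Type*} {n : ℕ} (s : Finset ι) (E : List (Fin q) → Prop)
    (F : ι → List (Fin q) → Prop) (h : ∀ w, w.length = n → E w → ∃ i ∈ s, F i w) :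
    Pr q n E ≤ ∑ i ∈ s, Pr q n (F i) := by
  unfold Pr
  rw [← Ex_sum]
  refine Ex_mono fun w hw => ?_
  by_cases hE : E w
  · obtain ⟨i, hi, hF⟩ := h w hw hE
    calc ind (E w) ≤ ind (F i w) := by simp [ind, hE, hF]
      _ ≤ _ := Finset.single_le_sum (f := fun i => ind (F i w)) (fun i _ => ind_nonneg _) hi
  · have : ind (E w) = 0 := by simp [ind, hE]
    rw [this]
    exact Finset.sum_nonneg fun i _ => ind_nonneg _

lemma geom_tail (hq : 2 ≤ q) (m n : ℕ) :
    ∑ j ∈ Finset.Icc (m + 1) n, (1 / (q : ℝ)) ^ j ≤ (1 / 2) ^ m := by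
  have hq' : (2 : ℝ) ≤ q := by exact_mod_cast hq
  have h1 : ∑ j ∈ Finset.Icc (m + 1) n, (1 / (q : ℝ)) ^ j ≤
      ∑ j ∈ Finset.Icc (m + 1) n, (1 / (2 : ℝ)) ^ j := by
    refine Finset.sum_le_sum fun j _ => ?_
    gcongr
  refine h1.trans ?_
  rcases le_total n m with h | h
  · rw [Finset.Icc_eq_empty (by omega)]; simp
  · obtain ⟨k, rfl⟩ := Nat.exists_eq_add_of_le h
    have : ∑ j ∈ Finset.Icc (m + 1) (m + k), (1 / (2 : ℝ)) ^ j = (1 / 2) ^ m - (1 / 2) ^ (m + k) := by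
      clear h h1
      induction k with
      | zero => simp
      | succ k ih =>
        rw [← add_assoc, Finset.sum_Icc_succ_top (by omega), ih]
        ring
    rw [this]
    have : (0 : ℝ) < (1 / 2) ^ (m + k) := by positivity
    linarith

lemma base_case (hq : 2 ≤ q) (V : List Γ) (x : Γ) (hx : V.count x = 1)
    (h2 : ∀ y ∈ V, y ≠ x → 2 ≤ V.count y) (m n : ℕ) :
    Pr q n (fun w => IsInstance V w ∧ ¬ Short m x V w) ≤
      ((V.toFinset.erase x).card : ℝ) * (1 / 2) ^ m := by
  classical
  let S : Others V x → Others V x → Finset ℕ :=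
    fun y z => if z = y then Finset.Icc (m + 1) n else Finset.Icc 1 n
  have h1 : Pr q n (fun w => IsInstance V w ∧ ¬ Short m x V w) ≤
      ∑ y : Others V x,
        Pr q n (fun w => ∃ l ∈ Fintype.piFinset (S y), HasLen V x l w) := by
    apply Pr_biUnion
    rintro w hw ⟨⟨φ, hφ, hφ'⟩, hns⟩
    have : ∃ y ∈ V, y ≠ x ∧ m < (φ y).length := by
      by_contra! hcon
      exact hns ⟨φ, hφ, hcon, hφ'⟩
    obtain ⟨y, hy, hyx, hmy⟩ := this
    refine ⟨⟨y, by simp [hy, hyx]⟩, Finset.mem_univ _, fun z => (φ z).length, ?_, φ, fun _ => rfl, hφ'⟩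
    rw [Fintype.mem_piFinset]
    intro z
    have hz := z.2
    rw [Finset.mem_erase, List.mem_toFinset] at hz
    have hzn : (φ z).length ≤ n := by
      rw [← hw, hφ', List.length_flatten, List.map_map]
      exact List.le_sum_of_mem (List.mem_map.2 ⟨z, hz.2, rfl⟩)
    have hz0 : 0 < (φ z).length := List.length_pos_iff.2 (hφ z hz.2)
    by_cases hzy : z = ⟨y, by simp [hy, hyx]⟩
    · have : (z : Γ) = y := congrArg Subtype.val hzy
      simp only [S, hzy, if_true, Finset.mem_Icc]
      rw [this] at hzn
      exact ⟨hmy, hzn⟩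
    · simp only [S, hzy, if_false, Finset.mem_Icc]
      exact ⟨hz0, hzn⟩
  refine h1.trans ?_
  have h3 : ∀ y : Others V x,
      Pr q n (fun w => ∃ l ∈ Fintype.piFinset (S y), HasLen V x l w) ≤ (1 / 2) ^ m := by
    intro y
    calc _ ≤ ∑ l ∈ Fintype.piFinset (S y), Pr q n (HasLen V x l) :=
          Pr_biUnion _ _ _ fun w _ h => h
      _ ≤ ∑ l ∈ Fintype.piFinset (S y), ∏ z, (1 / (q : ℝ)) ^ (l z) :=
          Finset.sum_le_sum fun l _ => Pr_hasLen (by omega) V x hx h2 l n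
      _ = ∏ z, ∑ j ∈ S y z, (1 / (q : ℝ)) ^ j := (Finset.prod_univ_sum _ _).symm
      _ ≤ ∏ z, (if z = y then (1 / 2 : ℝ) ^ m else 1) := by
          refine Finset.prod_le_prod (fun z _ => Finset.sum_nonneg fun j _ => by positivity) ?_
          intro z _
          by_cases hz : z = y
          · simp only [S, hz, if_true]
            exact geom_tail hq m n
          · simp only [S, hz, if_false]
            simpa using geom_tail hq 0 n
      _ = _ := by simp
  calc _ ≤ ∑ y : Others V x, (1 / 2 : ℝ) ^ m :=
        Finset.sum_le_sum fun y _ => h3 y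
    _ = _ := by simp

def Tight (q : ℕ) (x : Γ) (V : List Γ) : Prop :=
  ∀ ε : ℝ, 0 < ε → ∃ m N : ℕ, ∀ n, N ≤ n →
    Pr q n (fun w => IsInstance V w ∧ ¬ Short m x V w) ≤ ε

lemma flatten_reverse' {β : Type*} (φ : Γ → List β) (V : List Γ) :
    (V.reverse.map (fun c => (φ c).reverse)).flatten = ((V.map φ).flatten).reverse := by
  rw [List.reverse_flatten, List.map_map, List.map_reverse]
  rfl

lemma Short.reverse {β : Type*} {m : ℕ} {x : Γ} {V : List Γ} {W : List β}
    (h : Short m x V W) : Short m x V.reverse W.reverse := by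
  obtain ⟨φ, h1, h2, h3⟩ := h
  refine ⟨fun c => (φ c).reverse, ?_, ?_, ?_⟩
  · simpa using h1
  · simpa using h2
  · rw [flatten_reverse', h3]

lemma instance_reverse {β : Type*} {V : List Γ} {W : List β}
    (h : IsInstance V W) : IsInstance V.reverse W.reverse := by
  obtain ⟨φ, h1, h3⟩ := h
  refine ⟨fun c => (φ c).reverse, ?_, ?_⟩
  · simpa using h1
  · rw [flatten_reverse', h3]

lemma Tight.reverse {x : Γ} {V : List Γ} (h : Tight q x V) : Tight q x V.reverse := by
  intro ε hε
  obtain ⟨m, N, hN⟩ := h ε hε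
  refine ⟨m, N, fun n hn => ?_⟩
  refine le_trans ?_ (hN n hn)
  unfold Pr
  rw [← Ex_reverse]
  refine Pr_mono (E := fun w => IsInstance V.reverse w.reverse ∧ ¬ Short m x V.reverse w.reverse)
    ?_
  rintro w _ ⟨h1, h2⟩
  refine ⟨by simpa using instance_reverse h1, fun h => h2 h.reverse⟩

lemma exists_universal (q k : ℕ) :
    ∃ z : List (Fin q), ∀ w : List (Fin q), w.length ≤ k → w <:+: z := by
  have hf := List.finite_length_le (Fin q) k
  refine ⟨hf.toFinset.toList.flatten, fun w hw => ?_⟩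
  have hm : w ∈ hf.toFinset.toList := by simpa using hw
  obtain ⟨s, t, h⟩ := List.append_of_mem hm
  exact ⟨s.flatten, t.flatten, by rw [h]; simp⟩

lemma flatten_length_le {β : Type*} (φ : Γ → List β) (m : ℕ) (V : List Γ)
    (h : ∀ y ∈ V, (φ y).length ≤ m) : ((V.map φ).flatten).length ≤ V.length * m := by
  rw [List.length_flatten, List.map_map]
  have := List.sum_le_card_nsmul (V.map (List.length ∘ φ)) m (by simpa using h)
  simpa using this

lemma step_pointwise (hq : 0 < q) {x y : Γ} {A D B : List Γ} (hxA : x ∉ A) (hxD : x ∉ D)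
    (hxB : x ∉ B) (hyA : y ∉ A) (hyD : y ∉ D) (hyB : y ∉ B) (hyx : y ≠ x) {m k T : ℕ}
    (hk : (A.length + D.length + B.length) * (m + 1) ≤ k) {W z : List (Fin q)}
    (hz : ∀ w : List (Fin q), w.length ≤ k → w <:+: z)
    (hW : k + 1 + T + k + 1 ≤ W.length)
    (hS : Short m x (A ++ x :: B) W) (hzW : z <:+: (W.drop (k + 1)).take T) :
    Short (m + 1 + (k + 1 + T)) x (A ++ y :: (D ++ x :: B)) W := by
  obtain ⟨φ, h1, h2, h3⟩ := hS
  let ψ₀ : Γ → List (Fin q) := fun c => if c ∈ A ++ B then φ c else [⟨0, hq⟩]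
  have hψ₀m : ∀ c, c ≠ x → (ψ₀ c).length ≤ m + 1 := by
    intro c hc
    by_cases hcm : c ∈ A ++ B
    · simp only [ψ₀, hcm, if_true]
      have := h2 c (by simp at hcm ⊢; tauto) hc
      omega
    · simp only [ψ₀, hcm, if_false]
      simp
  have hψ₀n : ∀ c, ψ₀ c ≠ [] := by
    intro c
    by_cases hcm : c ∈ A ++ B
    · simp only [ψ₀, hcm, if_true]
      exact h1 c (by simp at hcm ⊢; tauto)
    · simp only [ψ₀, hcm, if_false]
      simp
  have hmapA : A.map φ = A.map ψ₀ := List.map_congr_left fun c hc => by simp [ψ₀, hc]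
  have hmapB : B.map φ = B.map ψ₀ := List.map_congr_left fun c hc => by simp [ψ₀, hc]
  have hne : ∀ {c : Γ} {E : List Γ}, c ∈ E → x ∉ E → c ≠ x := fun hc hx h => hx (h ▸ hc)
  have hlA := flatten_length_le ψ₀ (m + 1) A fun c hc => hψ₀m c (hne hc hxA)
  have hlB := flatten_length_le ψ₀ (m + 1) B fun c hc => hψ₀m c (hne hc hxB)
  have hlD := flatten_length_le ψ₀ (m + 1) D fun c hc => hψ₀m c (hne hc hxD)
  rw [add_mul, add_mul] at hk
  simp only [List.map_append, List.map_cons, List.flatten_append, List.flatten_cons, hmapA, hmapB]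
    at h3
  set a := (A.map ψ₀).flatten with ha
  set b := (B.map ψ₀).flatten with hb
  set d := (D.map ψ₀).flatten with hd
  have hdW : d <:+: (W.drop (k + 1)).take T := (hz d (by omega)).trans hzW
  obtain ⟨s, t, hst⟩ := hdW
  -- decompose `W`
  have hWdec : W = (W.take (k + 1) ++ s) ++ d ++ (t ++ W.drop (k + 1 + T)) := by
    calc W = W.take (k + 1) ++ W.drop (k + 1) := (List.take_append_drop _ _).symm
      _ = W.take (k + 1) ++ ((W.drop (k + 1)).take T ++ (W.drop (k + 1)).drop T) := by
          rw [List.take_append_drop T]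
      _ = _ := by rw [← hst, List.drop_drop]; simp
  have hlen := congrArg List.length hst
  simp only [List.length_append, List.length_take, List.length_drop] at hlen
  have hp1 : a <+: W := ⟨_, h3.symm⟩
  have hp2 : (W.take (k + 1) ++ s) <+: W := ⟨d ++ (t ++ W.drop (k + 1 + T)), by
    rw [← List.append_assoc]; exact hWdec.symm⟩
  have hs1 : b <:+ W := ⟨a ++ φ x, by rw [h3]; simp⟩
  have hs2 : (t ++ W.drop (k + 1 + T)) <:+ W := ⟨_, hWdec.symm⟩
  obtain ⟨s', hs'⟩ := List.prefix_of_prefix_length_le hp1 hp2 (by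
    simp only [List.length_append, List.length_take]; omega)
  obtain ⟨t', ht'⟩ := List.suffix_of_suffix_length_le hs1 hs2 (by
    simp only [List.length_append, List.length_drop]; omega)
  have hls := congrArg List.length hs'
  have hlt := congrArg List.length ht'
  simp only [List.length_append, List.length_take, List.length_drop] at hls hlt
  have hs'0 : s' ≠ [] := by
    rw [← List.length_pos_iff]; omega
  have ht'0 : t' ≠ [] := by
    rw [← List.length_pos_iff]; omega
  let ψ : Γ → List (Fin q) := fun c => if c = y then s' else if c = x then t' else ψ₀ c
  have hψ : ∀ E : List Γ, x ∉ E → y ∉ E → E.map ψ = E.map ψ₀ := by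
    intro E hxE hyE
    refine List.map_congr_left fun c hc => ?_
    have h1 : c ≠ x := fun h => hxE (h ▸ hc)
    have h2 : c ≠ y := fun h => hyE (h ▸ hc)
    simp [ψ, h1, h2]
  refine ⟨ψ, ?_, ?_, ?_⟩
  · intro c _
    simp only [ψ]
    split_ifs
    · exact hs'0
    · exact ht'0
    · exact hψ₀n c
  · intro c _ hc
    simp only [ψ, hc, if_false]
    split_ifs
    · omega
    · have := hψ₀m c hc
      omega
  · have hψy : ψ y = s' := by simp [ψ]
    have hψx : ψ x = t' := by simp [ψ, hyx.symm]
    simp only [List.map_append, List.map_cons, List.flatten_append, List.flatten_cons,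
      hψ A hxA hyA, hψ B hxB hyB, hψ D hxD hyD, hψy, hψx]
    rw [← ha, ← hb, ← hd, hWdec, ← hs', ← ht']
    simp

lemma step_left (hq : 0 < q) {x y : Γ} {A D B : List Γ} (hxA : x ∉ A) (hxD : x ∉ D)
    (hxB : x ∉ B) (hyA : y ∉ A) (hyD : y ∉ D) (hyB : y ∉ B) (hyx : y ≠ x)
    (h : Tight q x (A ++ x :: B)) : Tight q x (A ++ y :: (D ++ x :: B)) := by
  intro ε hε
  obtain ⟨m, N, hN⟩ := h (ε / 2) (by linarith)
  obtain ⟨k, hk⟩ : ∃ k, k = (A.length + D.length + B.length) * (m + 1) := ⟨_, rfl⟩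
  obtain ⟨z, hz⟩ := exists_universal q k
  obtain ⟨T, hT⟩ := exists_not_infix_le hq z (ε / 2) (by linarith)
  refine ⟨m + 1 + (k + 1 + T), max N (k + 1 + T + k + 1), fun n hn => ?_⟩
  have hn1 := (le_max_left _ _).trans hn
  have hn2 := (le_max_right _ _).trans hn
  have hT' := Pr_factor hq (k + 1) T n (by omega) (fun w => ¬ z <:+: w)
  have := hN n hn1
  calc _ ≤ Pr q n (fun w => IsInstance (A ++ x :: B) w ∧ ¬ Short m x (A ++ x :: B) w)
        + Pr q n (fun w => ¬ z <:+: (w.drop (k + 1)).take T) := by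
        refine Pr_union ?_
        rintro w hw ⟨⟨φ, h1, h2⟩, hns⟩
        by_contra! hcon
        obtain ⟨hc1, hc2⟩ := hcon
        refine hns (step_pointwise hq hxA hxD hxB hyA hyD hyB hyx hk.ge hz (by omega)
          (hc1 ?_) hc2)
        have hmap : ∀ E : List Γ, x ∉ E → 
            E.map (fun c => if c = x then φ y ++ ((D.map φ).flatten ++ φ x) else φ c) = E.map φ := by
          intro E hxE
          refine List.map_congr_left fun c hc => ?_
          have h1 : c ≠ x := fun h => hxE (h ▸ hc)
          simp [h1]
        refine ⟨fun c => if c = x then φ y ++ ((D.map φ).flatten ++ φ x) else φ c, ?_, ?_⟩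
        · intro c hc
          by_cases hcx : c = x
          · simp [hcx, h1 x]
          · simp only [hcx, if_false]
            exact h1 c (by simp at hc ⊢; tauto)
        · rw [h2]
          simp only [List.map_append, List.map_cons, List.flatten_append, List.flatten_cons,
            hmap A hxA, hmap B hxB, if_true, List.append_assoc]
    _ ≤ ε := by rw [hT']; linarith

lemma tight_one (x : Γ) (V : List Γ) (hx : V.count x = 1) : Tight 1 x V := by
  intro ε hε
  refine ⟨1, V.length, fun n hn => ?_⟩
  rw [Pr_false]
  · exact hε.le
  rintro w hw ⟨_, h⟩
  apply h
  have e1 := length_image V x hx (fun _ => [(0 : Fin 1)])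
  have e2 := length_image V x hx
    (fun c => if c = x then List.replicate (n - V.length + 1) (0 : Fin 1) else [(0 : Fin 1)])
  refine ⟨fun c => if c = x then List.replicate (n - V.length + 1) (0 : Fin 1) else [0], ?_, ?_, ?_⟩
  · intro c _
    by_cases hc : c = x <;> simp [hc]
  · intro c _ hc
    simp [hc]
  · apply List.ext_getElem
    · rw [e2, hw]
      have e3 : ∀ y : Others V x, (y : Γ) ≠ x := fun y => (Finset.mem_erase.1 y.2).1
      simp [e3] at e1 ⊢
      omega
    · intros; exact Subsingleton.elim _ _

lemma tight (hq : 0 < q) (x : Γ) : ∀ (n : ℕ) (V : List Γ), V.length = n → V.count x = 1 →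
    Tight q x V := by
  intro n
  induction n using Nat.strong_induction_on with
  | _ n ih =>
  intro V hn hx
  by_cases h2 : ∀ y ∈ V, y ≠ x → 2 ≤ V.count y
  · rcases Nat.lt_or_ge q 2 with h | h
    · obtain rfl : q = 1 := by omega
      exact tight_one x V hx
    · intro ε hε
      have ht : Tendsto (fun m : ℕ => ((V.toFinset.erase x).card : ℝ) * (1 / 2) ^ m) atTop
          (nhds (((V.toFinset.erase x).card : ℝ) * 0)) :=
        (tendsto_pow_atTop_nhds_zero_of_lt_one (by norm_num) (by norm_num)).const_mul _
      rw [mul_zero] at ht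
      obtain ⟨m, hm⟩ := (ht.eventually (ge_mem_nhds hε)).exists
      exact ⟨m, 0, fun n _ => (base_case h V x hx h2 m n).trans hm⟩
  · push Not at h2
    obtain ⟨y, hy, hyx, hy2⟩ := h2
    have hy1 : V.count y = 1 := by
      have := List.count_pos_iff.2 hy
      omega
    have hxV : x ∈ V := List.count_pos_iff.1 (by omega)
    obtain ⟨A, B, rfl⟩ := List.append_of_mem hxV
    have hxc : A.count x = 0 ∧ B.count x = 0 := by
      simp only [List.count_append, List.count_cons, beq_self_eq_true, if_true] at hx
      omega
    simp only [List.count_eq_zero] at hxc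
    obtain ⟨hxA, hxB⟩ := hxc
    have hy' : y ∈ A ∨ y ∈ B := by simpa [hyx] using hy
    rcases hy' with h | h
    · obtain ⟨A, D, rfl⟩ := List.append_of_mem h
      have : y ∉ A ∧ y ∉ D ∧ y ∉ B := by
        simp only [List.append_assoc, List.cons_append, List.count_append, List.count_cons,
          beq_self_eq_true, if_true] at hy1
        simp only [← List.count_eq_zero]
        omega
      simp only [List.append_assoc, List.cons_append]
      simp only [List.mem_append, List.mem_cons, not_or] at hxA
      refine step_left hq hxA.1 hxA.2.2 hxB this.1 this.2.1 this.2.2 hyx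
        (ih _ ?_ _ rfl ?_)
      · rw [← hn]; simp
      · simp [List.count_append, List.count_eq_zero.2 hxA.1,
          List.count_eq_zero.2 hxB]
    · obtain ⟨D, B, rfl⟩ := List.append_of_mem h
      have : y ∉ A ∧ y ∉ D ∧ y ∉ B := by
        simp only [List.count_append, List.count_cons,
          beq_self_eq_true, if_true] at hy1
        simp only [← List.count_eq_zero]
        omega
      simp only [List.mem_append, List.mem_cons, not_or] at hxB
      have hT : Tight q x (B.reverse ++ y :: (D.reverse ++ x :: A.reverse)) := by
        refine step_left hq (by simpa using hxB.2.2) (by simpa using hxB.1) (by simpa using hxA)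
          (by simpa using this.2.2) (by simpa using this.2.1) (by simpa using this.1) hyx
          (ih _ ?_ _ rfl ?_)
        · rw [← hn]; simp; omega
        · simp [List.count_append, List.count_eq_zero.2 hxA,
            List.count_eq_zero.2 hxB.2.2]
      simpa using hT.reverse

lemma short_swap {x : Γ} {A B : List Γ} (hxA : x ∉ A) (hxB : x ∉ B) {m k : ℕ}
    (hk : (A.length + B.length) * m ≤ k) {u v c c' : List (Fin q)} (hu : u.length = k)
    (hv : v.length = k) (hc' : c' ≠ []) (h : Short m x (A ++ x :: B) (u ++ (c ++ v))) :
    Short m x (A ++ x :: B) (u ++ (c' ++ v)) := by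
  obtain ⟨φ, h1, h2, h3⟩ := h
  have hne : ∀ {c : Γ} {E : List Γ}, c ∈ E → x ∉ E → c ≠ x := fun hc hx h => hx (h ▸ hc)
  have hlA := flatten_length_le φ m A fun c hc => h2 c (by simp [hc]) (hne hc hxA)
  have hlB := flatten_length_le φ m B fun c hc => h2 c (by simp [hc]) (hne hc hxB)
  rw [add_mul] at hk
  simp only [List.map_append, List.map_cons, List.flatten_append, List.flatten_cons] at h3
  obtain ⟨u', hu'⟩ := List.prefix_of_prefix_length_le
    (⟨_, h3.symm⟩ : (A.map φ).flatten <+: (u ++ (c ++ v))) (List.prefix_append u _) (by omega)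
  obtain ⟨v', hv'⟩ := List.suffix_of_suffix_length_le
    (⟨(A.map φ).flatten ++ φ x, by rw [h3]; simp⟩ : (B.map φ).flatten <:+ (u ++ (c ++ v)))
    (⟨u ++ c, by simp⟩ : v <:+ (u ++ (c ++ v))) (by omega)
  have hmap : ∀ E : List Γ, x ∉ E → 
      E.map (fun d => if d = x then u' ++ (c' ++ v') else φ d) = E.map φ := by
    intro E hxE
    refine List.map_congr_left fun d hd => ?_
    simp [hne hd hxE]
  refine ⟨fun d => if d = x then u' ++ (c' ++ v') else φ d, ?_, ?_, ?_⟩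
  · intro d hd
    by_cases hdx : d = x
    · simp [hdx, hc']
    · simp only [hdx, if_false]
      exact h1 d hd
  · intro d hd hdx
    simp only [hdx, if_false]
    exact h2 d hd hdx
  · simp only [List.map_append, List.map_cons, List.flatten_append, List.flatten_cons,
            hmap A hxA, hmap B hxB, if_true, ← hu', ← hv', List.append_assoc]

lemma short_const (hq : 0 < q) (x : Γ) (V : List Γ) (hx : V.count x = 1) (m : ℕ) :
    ∃ (N : ℕ) (K : ℝ), ∀ n, N ≤ n → Pr q n (Short m x V) = K := by
  have hxV : x ∈ V := List.count_pos_iff.1 (by omega)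
  obtain ⟨A, B, rfl⟩ := List.append_of_mem hxV
  have hxc : A.count x = 0 ∧ B.count x = 0 := by
    simp only [List.count_append, List.count_cons, beq_self_eq_true, if_true] at hx
    omega
  simp only [List.count_eq_zero] at hxc
  obtain ⟨hxA, hxB⟩ := hxc
  obtain ⟨k, hk⟩ : ∃ k, k = (A.length + B.length) * m := ⟨_, rfl⟩
  refine ⟨k + (1 + k), Ex q k (fun u => Pr q k (fun v =>
    Short m x (A ++ x :: B) (u ++ ([⟨0, hq⟩] ++ v)))), fun n hn => ?_⟩
  obtain ⟨l, rfl, hl⟩ : ∃ l, n = k + (l + k) ∧ 0 < l := ⟨n - k - k, by omega, by omega⟩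
  rw [Pr_append]
  refine Ex_congr fun u hu => ?_
  rw [Pr_append]
  conv_rhs => rw [← Ex_const hq (n := l) (Pr q k _)]
  refine Ex_congr fun c hc => Pr_congr fun v hv => ⟨?_, ?_⟩
  · exact short_swap hxA hxB hk.ge hu hv (by simp)
  · exact short_swap hxA hxB hk.ge hu hv (by rw [← List.length_pos_iff]; omega)

lemma tendsto_inst (hq : 0 < q) (x : Γ) (V : List Γ) (hx : V.count x = 1) :
    ∃ L : ℝ, Tendsto (fun n => Pr q n (IsInstance V)) atTop (nhds L) := by
  apply cauchySeq_tendsto_of_complete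
  rw [Metric.cauchySeq_iff']
  intro ε hε
  obtain ⟨m, N, hN⟩ := tight hq x _ V rfl hx (ε / 2) (by linarith)
  obtain ⟨N', K, hK⟩ := short_const hq x V hx m
  have key : ∀ n, max N N' ≤ n → K ≤ Pr q n (IsInstance V) ∧ Pr q n (IsInstance V) ≤ K + ε / 2 := by
    intro n hn
    have h1 := hN n ((le_max_left _ _).trans hn)
    have h2 := hK n ((le_max_right _ _).trans hn)
    rw [← h2]
    refine ⟨Pr_mono fun w _ h => h.isInstance, ?_⟩
    refine le_trans (Pr_union (F := Short m x V)
      (G := fun w => IsInstance V w ∧ ¬ Short m x V w) ?_) (by linarith)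
    intro w _ h
    tauto
  refine ⟨max N N', fun n hn => ?_⟩
  have h1 := key n hn
  have h2 := key _ le_rfl
  rw [Real.dist_eq, abs_lt]
  constructor <;> linarith

lemma instSubCount_eq (V : List Γ) (n : ℕ) (w : List (Fin q)) (hw : w.length = n) :
    (instSubCount V w : ℝ) = ∑ i ∈ Finset.range n, ∑ l ∈ Finset.range (n - i),
      ind (IsInstance V ((w.drop i).take (l + 1))) := by
  classical
  rw [Finset.sum_sigma']
  unfold ind instSubCount
  rw [Finset.sum_boole]
  congr 1
  rw [← Finset.card_image_of_injective (f := fun s : (Σ _ : ℕ, ℕ) => (s.1, s.1 + s.2 + 1))]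
  · apply Nat.subtype_card
    rintro ⟨i, j⟩
    simp only [Finset.mem_image, Finset.mem_filter, Finset.mem_sigma, Finset.mem_range,
      Prod.mk.injEq, Sigma.exists]
    constructor
    · rintro ⟨a, b, ⟨⟨h1, h2⟩, h3⟩, rfl, rfl⟩
      refine ⟨by omega, by omega, ?_⟩
      rwa [show a + b + 1 - a = b + 1 by omega]
    · rintro ⟨h1, h2, h3⟩
      refine ⟨i, j - i - 1, ⟨⟨by omega, by omega⟩, ?_⟩, rfl, by omega⟩
      rwa [show j - i - 1 + 1 = j - i by omega]
  · rintro ⟨a, b⟩ ⟨c, d⟩ h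
    simp only [Prod.mk.injEq] at h
    obtain ⟨rfl, h⟩ := h
    obtain rfl : b = d := by omega
    rfl

lemma expDensity_eq (hq : 0 < q) (V : List Γ) (n : ℕ) :
    expDensity V q n = (∑ i ∈ Finset.range n, ∑ l ∈ Finset.range (n - i),
      Pr q (l + 1) (IsInstance V)) / ((n + 1).choose 2 : ℝ) := by
  have h1 : expDensity V q n = Ex q n (fun w => (∑ i ∈ Finset.range n, ∑ l ∈ Finset.range (n - i),
      ind (IsInstance V ((w.drop i).take (l + 1)))) * (1 / ((n + 1).choose 2 : ℝ))) := by
    show Ex q n (fun w => instDensity V w) = _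
    refine Ex_congr fun w hw => ?_
    rw [← instSubCount_eq V n w hw]
    unfold instDensity
    rw [hw]; ring
  rw [h1, Ex_mul_const, Ex_sum, mul_one_div]
  congr 1
  refine Finset.sum_congr rfl fun i hi => ?_
  rw [Ex_sum]
  refine Finset.sum_congr rfl fun l hl => ?_
  rw [Finset.mem_range] at hi hl
  exact Pr_factor hq i (l + 1) n (by omega) (IsInstance V)

lemma weighted_cesaro (a : ℕ → ℝ) (L : ℝ) (h : Tendsto a atTop (nhds L)) :
    Tendsto (fun n : ℕ => (∑ i ∈ Finset.range n, ∑ l ∈ Finset.range (n - i), a (l + 1)) /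
      ((n + 1).choose 2 : ℝ)) atTop (nhds L) := by
  have hb : Tendsto (fun l => |a (l + 1) - L|) atTop (nhds 0) := by
    have := ((h.comp (tendsto_add_atTop_nat 1)).sub_const L).abs
    simpa using this
  have hc := hb.cesaro.const_mul 2
  rw [mul_zero] at hc
  rw [tendsto_iff_norm_sub_tendsto_zero]
  refine squeeze_zero' (Eventually.of_forall fun n => norm_nonneg _) ?_ hc
  filter_upwards [eventually_gt_atTop 0] with n hn
  have hn' : (0 : ℝ) < n := by exact_mod_cast hn
  have hch : ((n + 1).choose 2 : ℝ) = (n : ℝ) * (n + 1) / 2 := by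
    rw [Nat.cast_choose_two]; push_cast; ring
  have hcount : ∑ i ∈ Finset.range n, ∑ l ∈ Finset.range (n - i), L = (n : ℝ) * (n + 1) / 2 * L := by
    simp only [Finset.sum_const, Finset.card_range, nsmul_eq_mul]
    rw [← Finset.sum_mul]
    congr 1
    rw [Finset.sum_congr rfl (fun i hi => Nat.cast_sub (Finset.mem_range.1 hi).le)]
    rw [Finset.sum_sub_distrib]
    have := Finset.sum_range_id_mul_two n
    have h3 : (∑ i ∈ Finset.range n, (i : ℝ)) * 2 = n * (n - 1) := by
      have h4 : (((∑ i ∈ Finset.range n, i) * 2 : ℕ) : ℝ) = ((n * (n - 1) : ℕ) : ℝ) := by rw [this]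
      push_cast [Nat.cast_sub hn] at h4
      simpa using h4
    simp
    linarith
  have hsub : (∑ i ∈ Finset.range n, ∑ l ∈ Finset.range (n - i), a (l + 1)) /
      ((n + 1).choose 2 : ℝ) - L =
      (∑ i ∈ Finset.range n, ∑ l ∈ Finset.range (n - i), (a (l + 1) - L)) /
        ((n : ℝ) * (n + 1) / 2) := by
    simp only [Finset.sum_sub_distrib] at hcount ⊢
    rw [hcount, hch]
    field_simp
  rw [hsub, Real.norm_eq_abs, abs_div, abs_of_pos (show (0 : ℝ) < (n : ℝ) * (n + 1) / 2 by positivity),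
    div_le_iff₀ (by positivity)]
  have hS : 0 ≤ ∑ l ∈ Finset.range n, |a (l + 1) - L| := Finset.sum_nonneg fun _ _ => abs_nonneg _
  calc |∑ i ∈ Finset.range n, ∑ l ∈ Finset.range (n - i), (a (l + 1) - L)|
      ≤ ∑ i ∈ Finset.range n, ∑ l ∈ Finset.range n, |a (l + 1) - L| := by
        refine (Finset.abs_sum_le_sum_abs _ _).trans (Finset.sum_le_sum fun i _ => ?_)
        refine (Finset.abs_sum_le_sum_abs _ _).trans ?_
        exact Finset.sum_le_sum_of_subset_of_nonneg (Finset.range_mono (Nat.sub_le _ _))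
          fun _ _ _ => abs_nonneg _
    _ = n * ∑ l ∈ Finset.range n, |a (l + 1) - L| := by simp
    _ ≤ (n + 1) * ∑ l ∈ Finset.range n, |a (l + 1) - L| := by gcongr; linarith
    _ = _ := by field_simp

end
end Stmt13

theorem stmt13 {Γ : Type*} [DecidableEq Γ] (V : List Γ) (hV : V ≠ [])
    (hnd : ∃ x ∈ V, V.count x = 1) (q : ℕ) (hq : 0 < q) :
    ∃ L : ℝ, Tendsto (fun n => instProb V q n) atTop (nhds L) ∧
      Tendsto (fun n => expDensity V q n) atTop (nhds L) := by
  obtain ⟨x, _, hx⟩ := hnd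
  obtain ⟨L, hL⟩ := Stmt13.tendsto_inst hq x V hx
  refine ⟨L, ?_, ?_⟩
  · simpa only [Stmt13.Pr_eq_card, instProb] using hL
  · simp only [Stmt13.expDensity_eq hq]
    exact Stmt13.weighted_cesaro (fun n => Stmt13.Pr q n (IsInstance V)) L hL
end

section
/- Let V be a word whose distinct letters are x₀, x₁, …, x_n (n ≥ 1), where x₀ occurs exactly once in V and x_k occurs r_k ≥ 2 times in V for each 1 ≤ k ≤ n. Then for every integer q ≥ 2: underlineδ(V,q) ≤ I(V,q) and I(V,q) ≤ ∏_{k=1}^{n} 1/(q^{r_k − 1} − 1), where I(V,q) = lim_{m→∞} I_m(V,q) (which exists since V is not doubled). -/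
open Filter

section helpers
open Classical

/-- proportion of words satisfying `P` -/
noncomputable def pr {α : Type*} [Fintype α] (q : ℕ) (P : (α → Fin q) → Prop) : ℝ :=
  ((Finset.univ.filter P).card : ℝ) / (q : ℝ) ^ (Fintype.card α)

theorem pr_le_one {α : Type*} [Fintype α] (q : ℕ) (hq : 2 ≤ q) (P : (α → Fin q) → Prop) :
    pr q P ≤ 1 := by
  unfold pr
  apply div_le_one_of_le₀ _ (by positivity)
  calc ((Finset.univ.filter P).card : ℝ) ≤ ((Finset.univ : Finset (α → Fin q)).card : ℝ) := by
        exact_mod_cast Finset.card_filter_le _ _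
    _ = _ := by simp

theorem pr_mono {α : Type*} [Fintype α] (q : ℕ) {P Q : (α → Fin q) → Prop}
    (h : ∀ W, P W → Q W) : pr q P ≤ pr q Q := by
  unfold pr
  gcongr with W
  exact h W

theorem pr_comp {α β : Type*} [Fintype α] [Fintype β] (q : ℕ) (hq : 2 ≤ q)
    (f : α → β) (hf : Function.Injective f) (P : (α → Fin q) → Prop) :
    pr q (fun W : β → Fin q => P (fun a => W (f a))) = pr q P := by
  let e := Equiv.piEquivPiSubtypeProd (fun b => b ∈ Set.range f) (fun _ : β => Fin q)
  let g : α ≃ {b // b ∈ Set.range f} := Equiv.ofInjective f hf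
  have h1 : (Finset.univ.filter (fun W : β → Fin q => P (fun a => W (f a)))).card
      = (Finset.univ.filter P).card * q ^ (Fintype.card {b // ¬ b ∈ Set.range f}) := by
    rw [← Fintype.card_subtype, ← Fintype.card_subtype]
    have : Fintype.card ({b // ¬ b ∈ Set.range f} → Fin q) =
      q ^ (Fintype.card {b // ¬ b ∈ Set.range f}) := by simp
    rw [← this, ← Fintype.card_prod]
    apply Fintype.card_congr
    let e2 : (β → Fin q) ≃ (α → Fin q) × ({b // ¬ b ∈ Set.range f} → Fin q) :=
      e.trans ((Equiv.arrowCongr g.symm (Equiv.refl _)).prodCongr (Equiv.refl _))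
    have he2 : ∀ W, (e2 W).1 = fun a => W (f a) := fun W => rfl
    refine (e2.subtypeEquiv (q := fun z => P z.1) ?_).trans ?_
    · intro W; rw [he2]
    · exact ⟨fun z => (⟨z.1.1, z.2⟩, z.1.2), fun z => ⟨(z.1.1, z.2), z.1.2⟩,
        fun _ => rfl, fun _ => rfl⟩
  have h2 : Fintype.card β = Fintype.card α + Fintype.card {b // ¬ b ∈ Set.range f} := by
    rw [Fintype.card_congr g]
    have h3 := Fintype.card_subtype_compl (fun b => b ∈ Set.range f)
    have h4 := Fintype.card_subtype_le (fun b => b ∈ Set.range f)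
    omega
  unfold pr
  rw [h1, h2, pow_add]
  have : (q : ℝ) ≠ 0 := by positivity
  push_cast
  field_simp

theorem instProb_eq {Γ : Type*} (V : List Γ) (q m : ℕ) :
    instProb V q m = pr q (fun W : Fin m → Fin q => IsInstance V (List.ofFn W)) := by
  unfold instProb pr
  rw [Nat.card_eq_fintype_card, Fintype.card_subtype, Fintype.card_fin]
  congr!

theorem flatten_congr {Γ β : Type*} (V : List Γ) (φ ψ : Γ → List β) (h : ∀ a ∈ V, φ a = ψ a) :
    (V.map φ).flatten = (V.map ψ).flatten := by
  rw [List.map_congr_left h]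

theorem slice_ofFn {β : Type*} {N : ℕ} (W : Fin N → β) (i k : ℕ) (h : i + k ≤ N) :
    ((List.ofFn W).drop i).take k = List.ofFn (fun t : Fin k => W ⟨i + t, by omega⟩) := by
  apply List.ext_getElem
  · simp; omega
  · intro t h1 h2
    simp

theorem length_flatten {Γ β : Type*} [DecidableEq Γ] {n : ℕ} (V : List Γ)
    (x : Fin (n + 1) → Γ) (hinj : Function.Injective x)
    (hletters : V.toFinset = Finset.image x Finset.univ) (h0 : V.count (x 0) = 1)
    (φ : Γ → List β) :
    ((V.map φ).flatten).length =
      (φ (x 0)).length + ∑ k : Fin n, V.count (x k.succ) * (φ (x k.succ)).length := by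
  rw [List.length_flatten, List.map_map, Finset.sum_list_map_count, hletters,
    Finset.sum_image (fun a _ b _ h => hinj h), Fin.sum_univ_succ, h0]
  simp

/-- instance with prescribed lengths -/
def InstL {Γ β : Type*} {n : ℕ} (V : List Γ) (y : Fin n → Γ) (l : Fin n → ℕ) (U : List β) : Prop :=
  ∃ φ : Γ → List β, (∀ k, (φ (y k)).length = l k) ∧ U = (V.map φ).flatten

theorem instL_card {Γ : Type*} [DecidableEq Γ] {n : ℕ} (V : List Γ)
    (x : Fin (n + 1) → Γ) (hinj : Function.Injective x)
    (hletters : V.toFinset = Finset.image x Finset.univ)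
    (h0 : V.count (x 0) = 1)
    (hk : ∀ k : Fin n, 2 ≤ V.count (x k.succ))
    (q : ℕ) (hq : 2 ≤ q) (m : ℕ) (l : Fin n → ℕ) :
    pr q (fun W : Fin m → Fin q => InstL V (fun k => x k.succ) l (List.ofFn W)) ≤
      ∏ k, (((q : ℝ) ^ (V.count (x k.succ) - 1))⁻¹) ^ (l k) := by
  by_cases hne : ∃ W : Fin m → Fin q, InstL V (fun k => x k.succ) l (List.ofFn W)
  swap
  · push Not at hne
    have : pr q (fun W : Fin m → Fin q => InstL V (fun k => x k.succ) l (List.ofFn W)) = 0 := by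
      unfold pr
      simp [hne]
    rw [this]
    positivity
  have hlen : ∀ W : Fin m → Fin q, ∀ φ : Γ → List (Fin q), (∀ k : Fin n, (φ (x k.succ)).length = l k) →
      List.ofFn W = (V.map φ).flatten →
      m = (φ (x 0)).length + ∑ k : Fin n, V.count (x k.succ) * l k := by
    intro W φ h1 h2
    have := length_flatten V x hinj hletters h0 φ
    rw [← h2] at this
    simpa [h1] using this
  obtain ⟨W0, φ0, h01, h02⟩ := hne
  obtain ⟨l0, hl0⟩ : ∃ l0, l0 = (φ0 (x 0)).length := ⟨_, rfl⟩
  have hm := hlen W0 φ0 h01 h02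
  rw [← hl0] at hm
  have hcard : (Finset.univ.filter (fun W : Fin m → Fin q =>
      InstL V (fun k => x k.succ) l (List.ofFn W))).card ≤ q ^ (l0 + ∑ k, l k) := by
    rw [← Fintype.card_subtype]
    let T := List.Vector (Fin q) l0 × (∀ k : Fin n, List.Vector (Fin q) (l k))
    have hT : Fintype.card T = q ^ (l0 + ∑ k, l k) := by
      simp [T, pow_add, Finset.prod_pow_eq_pow_sum]
    rw [← hT]
    let F : {W : Fin m → Fin q // InstL V (fun k => x k.succ) l (List.ofFn W)} → T :=
      fun W => (⟨W.2.choose (x 0), by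
          have := hlen W.1 _ W.2.choose_spec.1 W.2.choose_spec.2
          omega⟩, fun k => ⟨W.2.choose (x k.succ), W.2.choose_spec.1 k⟩)
    apply Fintype.card_le_of_injective F
    intro W W' h
    apply Subtype.ext
    apply List.ofFn_injective
    rw [W.2.choose_spec.2, W'.2.choose_spec.2]
    apply flatten_congr
    intro a ha
    have ha' : a ∈ Finset.image x Finset.univ := by rw [← hletters]; simpa using ha
    obtain ⟨k, -, rfl⟩ := Finset.mem_image.1 ha'
    have e1 := congrArg (fun z => z.1.1) h
    have e2 := congrArg (fun z => z.2) h
    refine Fin.cases ?_ (fun k => ?_) k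
    · exact e1
    · exact congrArg Subtype.val (congrFun e2 k)
  have hsum : m = (l0 + ∑ k, l k) + ∑ k, (V.count (x k.succ) - 1) * l k := by
    rw [hm, add_assoc, ← Finset.sum_add_distrib]
    congr 1
    apply Finset.sum_congr rfl
    intro k _
    obtain ⟨c, hc⟩ : ∃ c, V.count (x k.succ) = c + 1 := ⟨V.count (x k.succ) - 1, by have := hk k; omega⟩
    rw [hc]; simp; ring
  have hprod : ∏ k, (((q : ℝ) ^ (V.count (x k.succ) - 1))⁻¹) ^ (l k) =
      ((q : ℝ) ^ (∑ k, (V.count (x k.succ) - 1) * l k))⁻¹ := by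
    rw [← Finset.prod_pow_eq_pow_sum, ← Finset.prod_inv_distrib]
    apply Finset.prod_congr rfl
    intro k _
    rw [inv_pow, pow_mul]
  have hq0 : (0 : ℝ) < q := by positivity
  unfold pr
  rw [hprod, Fintype.card_fin, div_le_iff₀ (by positivity)]
  calc _ ≤ (q : ℝ) ^ (l0 + ∑ k, l k) := by
        have h5 : _ ≤ ((q ^ (l0 + ∑ k, l k) : ℕ) : ℝ) := Nat.cast_le.2 hcard
        push_cast at h5
        convert h5
        rfl
    _ = _ := by
      conv_rhs => rw [hsum, pow_add _ (l0 + ∑ k, l k)]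
      field_simp

theorem pr_union {α ι : Type*} [Fintype α] (q : ℕ) (P R : (α → Fin q) → Prop)
    (T : Finset ι) (E : ι → (α → Fin q) → Prop) (h : ∀ W, P W → R W ∨ ∃ l ∈ T, E l W) :
    pr q P ≤ pr q R + ∑ l ∈ T, pr q (E l) := by
  unfold pr
  rw [← Finset.sum_div, ← add_div]
  gcongr
  have : Finset.univ.filter P ⊆ Finset.univ.filter R ∪ T.biUnion (fun l => Finset.univ.filter (E l)) := by
    intro W hW
    simpa using h W (by simpa using hW)
  have h2 := (Finset.card_le_card this).trans (Finset.card_union_le _ _)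
  have h3 := h2.trans (Nat.add_le_add_left Finset.card_biUnion_le _)
  exact_mod_cast h3

/-- truncated instance -/
def TrInst {Γ β : Type*} {n : ℕ} (V : List Γ) (y : Fin n → Γ) (L : ℕ) (U : List β) : Prop :=
  ∃ φ : Γ → List β, (∀ a ∈ V, φ a ≠ []) ∧ (∀ k, (φ (y k)).length ≤ L) ∧ U = (V.map φ).flatten

/-- partial products -/
noncomputable def FF {n : ℕ} (a : Fin n → ℝ) (L : ℕ) : ℝ := ∏ k, ∑ t ∈ Finset.Icc 1 L, a k ^ t

theorem FF_eq {n : ℕ} (a : Fin n → ℝ) (L : ℕ) :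
    FF a L = ∑ l ∈ Fintype.piFinset (fun _ : Fin n => Finset.Icc 1 L), ∏ k, a k ^ (l k) := by
  unfold FF
  rw [Finset.prod_univ_sum]

theorem FF_mono {n : ℕ} (a : Fin n → ℝ) (ha : ∀ k, 0 ≤ a k) : Monotone (FF a) := by
  intro L M h
  unfold FF
  apply Finset.prod_le_prod
  · intro k _
    exact Finset.sum_nonneg fun t _ => pow_nonneg (ha k) t
  · intro k _
    apply Finset.sum_le_sum_of_subset_of_nonneg
    · exact Finset.Icc_subset_Icc_right h
    · intro t _ _
      exact pow_nonneg (ha k) t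

theorem FF_tendsto {n : ℕ} (b : Fin n → ℝ) (hb : ∀ k, 1 < b k) :
    Tendsto (FF (fun k => (b k)⁻¹)) atTop (nhds (∏ k, 1 / (b k - 1))) := by
  unfold FF
  apply tendsto_finsetProd
  intro k _
  have h0 : 0 < b k := by linarith [hb k]
  have h := (hasSum_geometric_of_lt_one (inv_nonneg.2 h0.le) (inv_lt_one_of_one_lt₀ (hb k))).mul_left (b k)⁻¹
  have h2 := h.tendsto_sum_nat
  have e1 : (b k)⁻¹ * (1 - (b k)⁻¹)⁻¹ = 1 / (b k - 1) := by
    have : b k - 1 ≠ 0 := by linarith [hb k]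
    field_simp
  rw [e1] at h2
  convert h2 using 2 with L
  rw [Finset.range_eq_Ico, Finset.sum_congr rfl (fun i _ => (pow_succ' (b k)⁻¹ i).symm),
    Finset.sum_Ico_add' (fun i => (b k)⁻¹ ^ i) 0 L 1]
  rfl

end helpers
section helpers2
open Classical

theorem inst_le {Γ : Type*} [DecidableEq Γ] {n : ℕ} (V : List Γ)
    (x : Fin (n + 1) → Γ) (hinj : Function.Injective x)
    (hletters : V.toFinset = Finset.image x Finset.univ)
    (h0 : V.count (x 0) = 1)
    (hk : ∀ k : Fin n, 2 ≤ V.count (x k.succ))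
    (q : ℕ) (hq : 2 ≤ q) (m : ℕ) (R : (Fin m → Fin q) → Prop) (T : Finset (Fin n → ℕ))
    (h : ∀ W : Fin m → Fin q, ∀ φ : Γ → List (Fin q), (∀ a ∈ V, φ a ≠ []) →
      List.ofFn W = (V.map φ).flatten →
      (∀ k : Fin n, (φ (x k.succ)).length ∈ Finset.Icc 1 m) →
      R W ∨ (fun k : Fin n => (φ (x k.succ)).length) ∈ T) :
    instProb V q m ≤ pr q R +
      ∑ l ∈ T, ∏ k, (((q : ℝ) ^ (V.count (x k.succ) - 1))⁻¹) ^ (l k) := by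
  rw [instProb_eq]
  refine (pr_union q _ R T
    (fun l W => InstL V (fun k => x k.succ) l (List.ofFn W)) ?_).trans ?_
  · rintro W ⟨φ, h1, h2⟩
    have h3 : ∀ k : Fin n, (φ (x k.succ)).length ∈ Finset.Icc 1 m := by
      intro k
      have hmem : x k.succ ∈ V := List.count_pos_iff.1 (by have := hk k; omega)
      have hpos := List.length_pos_iff.2 (h1 _ hmem)
      have hl := length_flatten V x hinj hletters h0 φ
      rw [← h2, List.length_ofFn] at hl
      have hs := Finset.single_le_sum (f := fun k : Fin n => V.count (x k.succ) * (φ (x k.succ)).length)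
        (fun _ _ => Nat.zero_le _) (Finset.mem_univ k)
      have := hk k
      simp only [Finset.mem_Icc]
      refine ⟨hpos, ?_⟩
      nlinarith
    rcases h W φ h1 h2 h3 with h4 | h4
    · exact Or.inl h4
    · exact Or.inr ⟨_, h4, φ, fun _ => rfl, h2⟩
  · gcongr with l hl
    exact instL_card V x hinj hletters h0 hk q hq m l

theorem tr_const {Γ : Type*} [DecidableEq Γ] {n : ℕ} (V : List Γ)
    (x : Fin (n + 1) → Γ) (hinj : Function.Injective x)
    (hletters : V.toFinset = Finset.image x Finset.univ)
    (h0 : V.count (x 0) = 1)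
    (q : ℕ) (hq : 2 ≤ q) (L : ℕ) :
    ∃ t : ℝ, ∀ m, 2 * (L * V.length) + 1 ≤ m →
      pr q (fun W : Fin m → Fin q => TrInst V (fun k => x k.succ) L (List.ofFn W)) = t := by
  have hx0 : x 0 ∈ V := List.count_pos_iff.1 (by omega)
  obtain ⟨A, B, hAB⟩ := List.append_of_mem hx0
  have hA : x 0 ∉ A := by
    intro h
    have := List.count_pos_iff.2 h
    rw [hAB] at h0
    simp at h0
    omega
  have hB : x 0 ∉ B := by
    intro h
    have := List.count_pos_iff.2 h
    rw [hAB] at h0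
    simp at h0
    omega
  have hlet : ∀ a ∈ V, a ≠ x 0 → ∃ k : Fin n, a = x k.succ := by
    intro a ha hne
    have ha' : a ∈ Finset.image x Finset.univ := by rw [← hletters]; simpa using ha
    obtain ⟨k, -, rfl⟩ := Finset.mem_image.1 ha'
    rcases Fin.eq_zero_or_eq_succ k with rfl | ⟨j, rfl⟩
    · exact absurd rfl hne
    · exact ⟨j, rfl⟩
  obtain ⟨D, hD⟩ : ∃ D, D = L * V.length := ⟨_, rfl⟩
  rw [← hD]
  -- the flattened pieces are short
  have hshort : ∀ C : List Γ, C.length ≤ V.length → (∀ a ∈ C, a ∈ V ∧ a ≠ x 0) →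
      ∀ φ : Γ → List (Fin q), (∀ k : Fin n, (φ (x k.succ)).length ≤ L) →
      ((C.map φ).flatten).length ≤ D := by
    intro C hC hC' φ hφ
    rw [List.length_flatten, List.map_map]
    have := List.sum_le_card_nsmul (C.map (List.length ∘ φ)) L (by
      intro s hs
      obtain ⟨a, ha, rfl⟩ := List.mem_map.1 hs
      obtain ⟨k, rfl⟩ := hlet a (hC' a ha).1 (hC' a ha).2
      exact hφ k)
    simp only [List.length_map, smul_eq_mul] at this
    rw [hD]
    nlinarith
  have hA' : ∀ a ∈ A, a ∈ V ∧ a ≠ x 0 := fun a ha =>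
    ⟨by rw [hAB]; simp [ha], fun h => hA (h ▸ ha)⟩
  have hB' : ∀ a ∈ B, a ∈ V ∧ a ≠ x 0 := fun a ha =>
    ⟨by rw [hAB]; simp [ha], fun h => hB (h ▸ ha)⟩
  have hAl : A.length ≤ V.length := by rw [hAB]; simp
  have hBl : B.length ≤ V.length := by rw [hAB]; simp; omega
  let Q : (Fin D ⊕ Fin D → Fin q) → Prop := fun U =>
    ∃ φ : Γ → List (Fin q), (∀ k : Fin n, φ (x k.succ) ≠ []) ∧
      (∀ k : Fin n, (φ (x k.succ)).length ≤ L) ∧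
      (A.map φ).flatten <+: List.ofFn (fun t => U (Sum.inl t)) ∧
      (B.map φ).flatten <:+ List.ofFn (fun t => U (Sum.inr t))
  refine ⟨pr q Q, fun m hm => ?_⟩
  let f : Fin D ⊕ Fin D → Fin m := Sum.elim (fun t => ⟨0 + t, by omega⟩)
    (fun t => ⟨(m - D) + t, by omega⟩)
  have hf : Function.Injective f := by
    rintro (s | s) (t | t) h <;> simp [f, Fin.ext_iff] at h ⊢ <;> omega
  rw [← pr_comp q hq f hf Q]
  congr 1
  funext W
  have e1 : List.ofFn (fun t => W (f (Sum.inl t))) = (List.ofFn W).take D := by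
    have := slice_ofFn W 0 D (by omega)
    rw [List.drop_zero] at this
    exact this.symm
  have e2 : List.ofFn (fun t => W (f (Sum.inr t))) = (List.ofFn W).drop (m - D) := by
    have := slice_ofFn W (m - D) D (by omega)
    rw [List.take_of_length_le (by simp; omega)] at this
    exact this.symm
  have hlen : (List.ofFn W).length = m := List.length_ofFn
  simp only [Q, e1, e2]
  generalize List.ofFn W = w at hlen
  apply propext
  constructor
  · rintro ⟨φ, h1, h2, h3⟩
    refine ⟨φ, fun k => h1 _ ?_, h2, ?_, ?_⟩
    · have : x k.succ ∈ V.toFinset := by rw [hletters]; simp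
      simpa using this
    · rw [List.prefix_take_iff]
      refine ⟨?_, hshort A hAl hA' φ h2⟩
      rw [h3, hAB]; simp
    · have hs : (B.map φ).flatten <:+ w := by
        rw [h3, hAB]
        refine ⟨(A.map φ).flatten ++ φ (x 0), ?_⟩
        simp
      have hs2 := hshort B hBl hB' φ h2
      rw [List.suffix_iff_eq_drop] at hs
      rw [hs, hlen]
      rw [show m - ((B.map φ).flatten).length = (m - D) + (D - ((B.map φ).flatten).length) by omega,
        ← List.drop_drop]
      exact List.drop_suffix _ _
  · rintro ⟨φ, h1, h2, h3, h4⟩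
    rw [List.prefix_take_iff] at h3
    obtain ⟨⟨r, hr⟩, h3'⟩ := h3
    have hs2 := hshort B hBl hB' φ h2
    have h5 : (B.map φ).flatten <:+ w := h4.trans (List.drop_suffix _ _)
    have h6 : (B.map φ).flatten <:+ r := by
      refine List.suffix_of_suffix_length_le h5 ⟨_, hr⟩ ?_
      have := congrArg List.length hr
      rw [List.length_append, hlen] at this
      omega
    obtain ⟨c, hc⟩ := h6
    have hcne : c ≠ [] := by
      rintro rfl
      have := congrArg List.length hr
      rw [← hc, List.length_append, hlen, List.nil_append] at this
      omega
    have hne : ∀ k : Fin n, x k.succ ≠ x 0 := fun k h => Fin.succ_ne_zero k (hinj h)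
    refine ⟨Function.update φ (x 0) c, ?_, ?_, ?_⟩
    · intro a ha
      by_cases hax : a = x 0
      · subst hax; simpa using hcne
      · obtain ⟨k, rfl⟩ := hlet a ha hax
        rw [Function.update_of_ne hax]
        exact h1 k
    · intro k
      rw [Function.update_of_ne (hne k)]
      exact h2 k
    · rw [hAB, List.map_append, List.map_cons, List.flatten_append, List.flatten_cons,
        Function.update_self,
        flatten_congr A _ φ (fun a ha => Function.update_of_ne (hA' a ha).2 _ _),
        flatten_congr B _ φ (fun a ha => Function.update_of_ne (hB' a ha).2 _ _), hc, hr]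

theorem exp_bound {Γ : Type*} (V : List Γ) (q : ℕ) (hq : 2 ≤ q) (N : ℕ) (c : ℝ)
    (h : ∀ W : Fin N → Fin q, c ≤ (instSubCount V (List.ofFn W) : ℝ)) :
    c ≤ ∑ j ∈ Finset.range (N + 1), ∑ i ∈ Finset.range j, instProb V q (j - i) := by
  have hq0 : (0 : ℝ) < q := by positivity
  have h1 : ∀ W : Fin N → Fin q, (instSubCount V (List.ofFn W) : ℝ) =
      ∑ j ∈ Finset.range (N + 1), ∑ i ∈ Finset.range j,
        if IsInstance V (((List.ofFn W).drop i).take (j - i)) then (1 : ℝ) else 0 := by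
    intro W
    have : instSubCount V (List.ofFn W) = (((Finset.range (N + 1)).sigma (fun j => Finset.range j)).filter
        (fun p => IsInstance V (((List.ofFn W).drop p.2).take (p.1 - p.2)))).card := by
      unfold instSubCount
      rw [← Fintype.card_coe, ← Nat.card_eq_fintype_card]
      refine Nat.card_congr ⟨fun p => ⟨⟨p.1.2, p.1.1⟩, ?_⟩, fun p => ⟨(p.1.2, p.1.1), ?_⟩,
        fun _ => rfl, fun _ => rfl⟩
      · have h1 := p.2.1
        have h2 := p.2.2.1
        have h2 := h2.trans_eq (List.length_ofFn (f := W))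
        simp only [Finset.mem_filter, Finset.mem_sigma, Finset.mem_range]
        exact ⟨⟨by omega, h1⟩, p.2.2.2⟩
      · have h3 := p.2
        simp only [Finset.mem_filter, Finset.mem_sigma, Finset.mem_range] at h3
        refine ⟨h3.1.2, ?_, h3.2⟩
        rw [List.length_ofFn]
        omega
    rw [this, Finset.sum_sigma', Finset.card_filter]
    push_cast
    rfl
  have h2 : ∀ j ∈ Finset.range (N + 1), ∀ i ∈ Finset.range j,
      ∑ W : Fin N → Fin q, (if IsInstance V (((List.ofFn W).drop i).take (j - i)) then (1 : ℝ) else 0)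
        = q ^ N * instProb V q (j - i) := by
    intro j hj i hi
    simp only [Finset.mem_range] at hj hi
    have := pr_comp q hq (fun t : Fin (j - i) => (⟨i + t, by omega⟩ : Fin N))
      (fun s t h => by simpa [Fin.ext_iff] using h)
      (fun U => IsInstance V (List.ofFn U))
    rw [instProb_eq, ← this, Finset.sum_boole]
    unfold pr
    rw [Fintype.card_fin, mul_div_cancel₀ _ (by positivity)]
    have h4 : ∀ W : Fin N → Fin q, ((List.ofFn W).drop i).take (j - i) =
        List.ofFn (fun t : Fin (j - i) => W ⟨i + t, by omega⟩) :=
      fun W => slice_ofFn W i (j - i) (by omega)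
    simp only [h4]
    congr!
  have h3 : ∑ W : Fin N → Fin q, c ≤ ∑ W : Fin N → Fin q, (instSubCount V (List.ofFn W) : ℝ) :=
    Finset.sum_le_sum fun W _ => h W
  simp only [h1] at h3
  rw [Finset.sum_comm, Finset.sum_congr rfl (fun j hj => Finset.sum_comm.trans
    (Finset.sum_congr rfl (h2 j hj)))] at h3
  simp only [← Finset.mul_sum] at h3
  simp at h3
  exact le_of_mul_le_mul_left h3 (by positivity)

theorem liminf_le {Γ : Type*} (V : List Γ) (q : ℕ) (hq : 2 ≤ q) (I : ℝ)
    (hI : Tendsto (fun m => instProb V q m) atTop (nhds I)) : liminfDensity V q ≤ I := by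
  have hp0 : ∀ m, 0 ≤ instProb V q m := fun m => by unfold instProb; positivity
  have hp1 : ∀ m, instProb V q m ≤ 1 := fun m => by rw [instProb_eq]; exact pr_le_one q hq _
  have hI0 : 0 ≤ I := ge_of_tendsto' hI hp0
  by_contra hlt
  push Not at hlt
  obtain ⟨c, hc1, hc2⟩ := exists_between hlt
  obtain ⟨c', hc3, hc4⟩ := exists_between hc1
  have hev := eventually_lt_of_lt_liminf hc2 (by
    refine Filter.isBoundedUnder_of ⟨0, fun W => ?_⟩
    show (0 : ℝ) ≤ instDensity V W
    unfold instDensity; positivity)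
  rw [eventually_comap] at hev
  obtain ⟨N0, hN0⟩ := eventually_atTop.1 hev
  obtain ⟨M, hM⟩ := eventually_atTop.1 (hI.eventually_lt_const hc3)
  have key : ∀ N, N0 ≤ N → 1 ≤ N → c * ((N + 1).choose 2 : ℝ) ≤
      c' * ((N + 1).choose 2 : ℝ) + M * (N + 1) := by
    intro N hN hN1
    have hpos : (0 : ℝ) < ((N + 1).choose 2 : ℝ) := by
      exact_mod_cast Nat.choose_pos (by omega)
    refine (exp_bound V q hq N _ ?_).trans ?_
    · intro W
      have := hN0 N hN (List.ofFn W) (by simp)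
      unfold instDensity at this
      rw [List.length_ofFn, lt_div_iff₀ hpos] at this
      exact this.le
    · have hb : ∀ j ∈ Finset.range (N + 1), ∑ i ∈ Finset.range j, instProb V q (j - i) ≤
          c' * j + M := by
        intro j _
        calc ∑ i ∈ Finset.range j, instProb V q (j - i)
            ≤ ∑ i ∈ Finset.range j, (c' + if j < M + i then 1 else 0) := by
              apply Finset.sum_le_sum
              intro i hi
              rw [Finset.mem_range] at hi
              split_ifs with hh
              · linarith [hp1 (j - i)]
              · have := hM (j - i) (by omega)
                linarith
          _ = c' * j + (((Finset.range j).filter (fun i => j < M + i)).card : ℝ) := by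
              rw [Finset.sum_add_distrib, Finset.sum_boole]
              simp [mul_comm]
          _ ≤ c' * j + M := by
              gcongr
              have : (Finset.range j).filter (fun i => j < M + i) ⊆ Finset.Ico (j - M) j := by
                intro i hi
                simp at hi ⊢
                omega
              have := Finset.card_le_card this
              rw [Nat.card_Ico] at this
              omega
      refine (Finset.sum_le_sum hb).trans (le_of_eq ?_)
      rw [Finset.sum_add_distrib, ← Finset.mul_sum, ← Nat.cast_sum, Finset.sum_range_id,
        Nat.choose_two_right]
      simp [mul_comm]
  obtain ⟨N, hN⟩ := exists_nat_gt (2 * M / (c - c') : ℝ)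
  have hcc : 0 < c - c' := by linarith
  rw [div_lt_iff₀ hcc] at hN
  have := key (N + N0 + 1) (by omega) (by omega)
  rw [Nat.cast_choose_two] at this
  push_cast at this
  have hN0' : (0 : ℝ) ≤ N0 := by positivity
  have hNN : (0 : ℝ) ≤ N := by positivity
  have h1 : (c - c') * ((N + N0 + 1 + 1) * (N + N0 + 1)) ≤ 2 * M * (N + N0 + 1 + 1 : ℝ) := by
    linarith
  have h2 : (c - c') * (N + N0 + 1) ≤ 2 * (M : ℝ) := by
    have hp : (0 : ℝ) < N + N0 + 1 + 1 := by positivity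
    apply le_of_mul_le_mul_right _ hp
    linarith
  nlinarith

end helpers2

theorem stmt14 {Γ : Type*} [DecidableEq Γ] (n : ℕ) (hn : 1 ≤ n) (V : List Γ)
    (x : Fin (n + 1) → Γ) (hinj : Function.Injective x)
    (hletters : V.toFinset = Finset.image x Finset.univ)
    (h0 : V.count (x 0) = 1)
    (hk : ∀ k : Fin (n + 1), k ≠ 0 → 2 ≤ V.count (x k))
    (q : ℕ) (hq : 2 ≤ q) :
    ∃ I : ℝ, Tendsto (fun m => instProb V q m) atTop (nhds I) ∧
      liminfDensity V q ≤ I ∧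
      I ≤ ∏ k ∈ Finset.univ.erase (0 : Fin (n + 1)),
            1 / ((q : ℝ) ^ (V.count (x k) - 1) - 1) := by

  have hk' : ∀ k : Fin n, 2 ≤ V.count (x k.succ) := fun k => hk _ (Fin.succ_ne_zero k)
  have hq1 : (1 : ℝ) < q := by exact_mod_cast hq
  let b : Fin n → ℝ := fun k => (q : ℝ) ^ (V.count (x k.succ) - 1)
  have hb : ∀ k, 1 < b k := fun k => one_lt_pow₀ hq1 (by have := hk' k; omega)
  let a : Fin n → ℝ := fun k => (b k)⁻¹
  have ha : ∀ k, 0 ≤ a k := fun k => inv_nonneg.2 (by linarith [hb k])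
  have hF := FF_tendsto b hb
  have hmono : Monotone (FF a) := FF_mono a ha
  have hprod : ∏ k ∈ Finset.univ.erase (0 : Fin (n + 1)),
            1 / ((q : ℝ) ^ (V.count (x k) - 1) - 1) = ∏ k, 1 / (b k - 1) := by
    rw [Fin.univ_succ, Finset.erase_cons, Finset.prod_map]
    rfl
  rw [hprod]
  set F := ∏ k, 1 / (b k - 1) with hFdef
  have hle : ∀ L, FF a L ≤ F := fun L => hmono.ge_of_tendsto hF L
  have hbound : ∀ m, instProb V q m ≤ F := by
    intro m
    have := inst_le V x hinj hletters h0 hk' q hq m (fun _ => False)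
      (Fintype.piFinset (fun _ => Finset.Icc 1 m)) (by
        intro W φ _ _ h3
        right
        rw [Fintype.mem_piFinset]
        exact h3)
    have hz : pr q (fun _ : Fin m → Fin q => False) = 0 := by simp [pr]
    rw [hz, zero_add] at this
    exact (this.trans (FF_eq a m).symm.le).trans (hle m)
  have htail : ∀ L m, L ≤ m → instProb V q m ≤
      pr q (fun W : Fin m → Fin q => TrInst V (fun k => x k.succ) L (List.ofFn W)) + (F - FF a L) := by
    intro L m hLm
    have hsub : Fintype.piFinset (fun _ : Fin n => Finset.Icc 1 L) ⊆
        Fintype.piFinset (fun _ : Fin n => Finset.Icc 1 m) :=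
      Fintype.piFinset_subset _ _ (fun _ => Finset.Icc_subset_Icc_right hLm)
    have := inst_le V x hinj hletters h0 hk' q hq m
      (fun W : Fin m → Fin q => TrInst V (fun k => x k.succ) L (List.ofFn W))
      (Fintype.piFinset (fun _ => Finset.Icc 1 m) \ Fintype.piFinset (fun _ => Finset.Icc 1 L)) (by
        intro W φ h1 h2 h3
        by_cases h4 : ∀ k : Fin n, (φ (x k.succ)).length ≤ L
        · exact Or.inl ⟨φ, h1, h4, h2⟩
        · right
          rw [Finset.mem_sdiff, Fintype.mem_piFinset, Fintype.mem_piFinset]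
          refine ⟨h3, fun h5 => h4 fun k => (Finset.mem_Icc.1 (h5 k)).2⟩)
    have hs := Finset.sum_sdiff (f := fun l : Fin n → ℕ => ∏ k, a k ^ l k) hsub
    rw [← FF_eq, ← FF_eq] at hs
    have h6 := hle m
    simp only [a, b] at *
    linarith
  have hlow : ∀ L m, pr q (fun W : Fin m → Fin q => TrInst V (fun k => x k.succ) L (List.ofFn W))
      ≤ instProb V q m := by
    intro L m
    rw [instProb_eq]
    apply pr_mono
    rintro W ⟨φ, h1, _, h3⟩
    exact ⟨φ, h1, h3⟩
  have hcauchy : CauchySeq (fun m => instProb V q m) := by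
    rw [Metric.cauchySeq_iff]
    intro ε hε
    obtain ⟨L, hL⟩ := (hF.eventually_const_lt (show F - ε < F by linarith)).exists
    obtain ⟨t, ht⟩ := tr_const V x hinj hletters h0 q hq L
    refine ⟨max L (2 * (L * V.length) + 1), fun m hm m' hm' => ?_⟩
    have a1 := htail L m (le_trans (le_max_left _ _) hm)
    have a2 := htail L m' (le_trans (le_max_left _ _) hm')
    have a3 := hlow L m
    have a4 := hlow L m'
    rw [ht m (le_trans (le_max_right _ _) hm)] at a1 a3
    rw [ht m' (le_trans (le_max_right _ _) hm')] at a2 a4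
    have hL' : F - ε < FF a L := hL
    rw [Real.dist_eq, abs_lt]
    constructor <;> linarith
  obtain ⟨I, hI⟩ := cauchySeq_tendsto_of_complete hcauchy
  exact ⟨I, hI, liminf_le V q hq I hI, le_of_tendsto' hI hbound⟩
end

section
/- Let V be a nonempty doubled word, let q ≥ 2 be an integer, and let W_n be a uniformly random q-ary word of length n. Then there exist a constant C > 0 and N such that for all n ≥ N, the variance of δ(V,W_n) satisfies Var(δ(V,W_n)) ≤ C·(log n)³/n³. -/
open Filter

namespace Stmt18Aux

lemma flatten_inj {Γ β : Type*} (D : List Γ) (φ ψ : Γ → List β)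
    (hl : ∀ x ∈ D, (φ x).length = (ψ x).length)
    (h : (D.map φ).flatten = (D.map ψ).flatten) : ∀ x ∈ D, φ x = ψ x := by
  induction D with
  | nil => simp
  | cons a D ih =>
    simp only [List.map_cons, List.flatten_cons] at h
    obtain ⟨h1, h2⟩ := List.append_inj h (hl a (by simp))
    intro x hx
    rcases List.mem_cons.1 hx with rfl | hx
    · exact h1
    · exact ih (fun y hy => hl y (by simp [hy])) h2 x hx

lemma len_sum {Γ β : Type*} [DecidableEq Γ] (V : List Γ) (φ : Γ → List β) :
    ((V.map φ).flatten).length = ∑ x ∈ V.toFinset, V.count x * (φ x).length := by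
  rw [List.length_flatten, List.map_map, Finset.sum_list_map_count]
  simp

lemma exists_code {Γ : Type*} [DecidableEq Γ] (V : List Γ) (hd : Doubled V) (q m : ℕ)
    (hq : 0 < q) :
    ∃ c : List (Fin q) → ((↥V.toFinset → Fin (m+1)) × (Fin (m/2) → Fin q)),
      ∀ U U', U.length = m → U'.length = m → IsInstance V U → IsInstance V U' →
        c U = c U' → U = U' := by
  classical
  have key : ∀ U : List (Fin q), ∃ φ : Γ → List (Fin q), U.length = m → IsInstance V U →
      U = (V.map φ).flatten := by
    intro U
    by_cases h : IsInstance V U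
    · obtain ⟨φ, -, h2⟩ := h
      exact ⟨φ, fun _ _ => h2⟩
    · exact ⟨fun _ => [], fun _ h' => absurd h' h⟩
  choose φ hφ using key
  let E : List (Fin q) → List (Fin q) := fun U => (V.toFinset.toList.map (φ U)).flatten
  have hElen : ∀ U, (E U).length = ∑ x ∈ V.toFinset, (φ U x).length := by
    intro U
    simp only [E]
    rw [List.length_flatten, List.map_map, Finset.sum_map_toList]
    rfl
  have hE2 : ∀ U, U.length = m → IsInstance V U → (E U).length ≤ m / 2 := by
    intro U hU hi
    have h1 := len_sum V (φ U)
    rw [← hφ U hU hi, hU] at h1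
    have h2 : ∑ x ∈ V.toFinset, 2 * (φ U x).length ≤ m := by
      rw [h1]
      apply Finset.sum_le_sum
      intro x hx
      exact Nat.mul_le_mul_right _ (hd x (by simpa using hx))
    rw [← Finset.mul_sum, ← hElen] at h2
    omega
  have ha : ∀ U, U.length = m → IsInstance V U → ∀ x ∈ V.toFinset, (φ U x).length ≤ m := by
    intro U hU hi x hx
    have h1 := hE2 U hU hi
    rw [hElen] at h1
    have := Finset.single_le_sum (f := fun x => (φ U x).length) (fun _ _ => Nat.zero_le _) hx
    omega
  refine ⟨fun U => (fun x => Fin.ofNat (m+1) (φ U x).length,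
    fun k => (E U).getD k ⟨0, hq⟩), ?_⟩
  intro U U' hU hU' hi hi' hc
  obtain ⟨hc1, hc2⟩ := Prod.mk.inj hc
  have hlen : ∀ x ∈ V.toFinset, (φ U x).length = (φ U' x).length := by
    intro x hx
    have := congrArg Fin.val (congrFun hc1 ⟨x, hx⟩)
    simp only [Fin.ofNat] at this
    rwa [Nat.mod_eq_of_lt (Nat.lt_succ_of_le (ha U hU hi x hx)),
      Nat.mod_eq_of_lt (Nat.lt_succ_of_le (ha U' hU' hi' x hx))] at this
  have hEE : E U = E U' := by
    apply List.ext_getElem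
    · rw [hElen, hElen]
      exact Finset.sum_congr rfl hlen
    · intro k h1 h2
      have := congrFun hc2 ⟨k, lt_of_lt_of_le h1 (hE2 U hU hi)⟩
      simpa [List.getD_eq_getElem, h1, h2] using this
  have hφφ := flatten_inj _ _ _ (fun x hx => hlen x (by simpa using hx)) hEE
  rw [hφ U hU hi, hφ U' hU' hi']
  congr 1
  apply List.map_congr_left
  intro x hx
  exact hφφ x (by simpa using hx)

/-- segment of a word -/
def seg {q n : ℕ} (p : ℕ × ℕ) (W : Fin n → Fin q) : List (Fin q) :=
  ((List.ofFn W).drop p.1).take (p.2 - p.1)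

lemma seg_len {q n : ℕ} (p : ℕ × ℕ) (hp : p.2 ≤ n) (W : Fin n → Fin q) :
    (seg p W).length = p.2 - p.1 := by
  simp [seg]; omega

lemma seg_eq_iff {q n : ℕ} (p : ℕ × ℕ) (hp : p.2 ≤ n) (W W' : Fin n → Fin q) :
    seg p W = seg p W' ↔ ∀ k : Fin n, p.1 ≤ k → k < p.2 → W k = W' k := by
  constructor
  · intro h k h1 h2
    have h3 : (seg p W)[(k:ℕ) - p.1]? = (seg p W')[(k:ℕ) - p.1]? := by rw [h]
    have h4 : (k:ℕ) - p.1 < p.2 - p.1 := by omega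
    have h5 : p.1 + ((k:ℕ) - p.1) = k := by omega
    simpa [seg, List.getElem?_take, h4, h5] using h3
  · intro h
    apply List.ext_getElem
    · rw [seg_len p hp, seg_len p hp]
    · intro k h1 h2
      rw [seg_len p hp] at h1
      simp only [seg, List.getElem_take, List.getElem_drop, List.getElem_ofFn]
      apply h <;> simp <;> omega

open Classical in
lemma card_bound {Γ : Type*} [DecidableEq Γ] (V : List Γ) (hd : Doubled V) (q n : ℕ)
    (hq : 0 < q) (p : ℕ × ℕ) (hp : p.2 ≤ n) :
    (Finset.univ.filter (fun W : Fin n → Fin q => IsInstance V (seg p W))).card ≤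
      (p.2 - p.1 + 1) ^ V.toFinset.card * q ^ ((p.2 - p.1) / 2) * q ^ (n - (p.2 - p.1)) := by
  obtain ⟨c, hc⟩ := exists_code V hd q (p.2 - p.1) hq
  have hinj : Set.InjOn (fun W : Fin n → Fin q => (c (seg p W),
      (fun k : {k : Fin n // ¬ (k ∈ Finset.univ.filter (fun k : Fin n => p.1 ≤ k ∧ k < p.2))} => W k)))
      (Finset.univ.filter (fun W : Fin n → Fin q => IsInstance V (seg p W))) := by
    intro W hW W' hW' h
    obtain ⟨h1, h2⟩ := Prod.mk.inj h
    simp only [Finset.coe_filter, Finset.mem_univ, true_and, Set.mem_ofPred_eq] at hW hW'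
    have h3 := hc _ _ (seg_len p hp W) (seg_len p hp W') hW hW' h1
    rw [seg_eq_iff p hp] at h3
    funext k
    by_cases hk : p.1 ≤ k ∧ k < p.2
    · exact h3 k hk.1 hk.2
    · exact congrFun h2 ⟨k, by simpa using hk⟩
  have h := Finset.card_le_card_of_injOn _ (t := Finset.univ) (fun _ _ => Finset.mem_univ _) hinj
  refine h.trans (le_of_eq ?_)
  have hcard : (Finset.univ.filter (fun k : Fin n => p.1 ≤ k ∧ k < p.2)).card = p.2 - p.1 := by
    rw [← Nat.card_Ico, ← Finset.card_map Fin.valEmbedding]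
    congr 1
    ext k
    simp only [Finset.mem_map, Finset.mem_filter, Finset.mem_univ, true_and, Finset.mem_Ico,
      Fin.valEmbedding_apply]
    constructor
    · rintro ⟨a, ha, rfl⟩; exact ha
    · intro hk; exact ⟨⟨k, by omega⟩, hk, rfl⟩
  rw [Finset.card_univ, Fintype.card_prod, Fintype.card_prod, Fintype.card_fun, Fintype.card_fun,
    Fintype.card_fun, Fintype.card_subtype_compl]
  simp only [Fintype.card_coe, Fintype.card_fin, hcard]

/-- product formula for functions depending on complementary coordinates -/
lemma indep {q n : ℕ} (S : Fin n → Prop) [DecidablePred S] (f g : (Fin n → Fin q) → ℝ)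
    (hf : ∀ W W', (∀ k, S k → W k = W' k) → f W = f W')
    (hg : ∀ W W', (∀ k, ¬ S k → W k = W' k) → g W = g W') :
    (∑ W, f W) * (∑ W, g W) = (q:ℝ)^n * ∑ W, f W * g W := by
  let mix : (Fin n → Fin q) → (Fin n → Fin q) → (Fin n → Fin q) :=
    fun W W' k => if S k then W k else W' k
  let T : (Fin n → Fin q) × (Fin n → Fin q) → (Fin n → Fin q) × (Fin n → Fin q) :=
    fun x => (mix x.1 x.2, mix x.2 x.1)
  have hT : Function.Involutive T := by
    intro x
    ext k <;> simp only [T, mix] <;> split_ifs <;> rfl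
  rw [Finset.sum_mul_sum, ← Finset.sum_product']
  rw [Finset.univ_product_univ]
  have : ∀ x : (Fin n → Fin q) × (Fin n → Fin q), f x.1 * g x.2 = f (T x).1 * g (T x).1 := by
    intro x
    congr 1
    · apply hf; intro k hk; simp [T, mix, hk]
    · apply hg; intro k hk; simp [T, mix, hk]
  rw [Finset.sum_congr rfl (fun x _ => this x)]
  have h2 : ∑ x, f (T x).1 * g (T x).1 =
      ∑ x : (Fin n → Fin q) × (Fin n → Fin q), f x.1 * g x.1 :=
    Equiv.sum_comp (hT.toPerm) (fun x => f x.1 * g x.1)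
  rw [h2]
  rw [Fintype.sum_prod_type]
  simp [Finset.mul_sum]

end Stmt18Aux
namespace Stmt18Aux

open Classical in
/-- indicator of the event that a segment is an instance -/
noncomputable def ind {Γ : Type*} {q n : ℕ} (V : List Γ) (p : ℕ × ℕ) (W : Fin n → Fin q) : ℝ :=
  if IsInstance V (seg p W) then 1 else 0

/-- position pairs -/
def pairs (n : ℕ) : Finset (ℕ × ℕ) :=
  ((Finset.range (n+1)) ×ˢ (Finset.range (n+1))).filter (fun p => p.1 < p.2)

lemma mem_pairs {n : ℕ} {p : ℕ × ℕ} : p ∈ pairs n ↔ p.1 < p.2 ∧ p.2 ≤ n := by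
  simp [pairs]; omega

lemma count_eq {Γ : Type*} {q n : ℕ} (V : List Γ) (W : Fin n → Fin q) :
    (instSubCount V (List.ofFn W) : ℝ) = ∑ p ∈ pairs n, ind V p W := by
  classical
  unfold instSubCount ind
  rw [Finset.sum_boole]
  congr 1
  refine Nat.subtype_card _ ?_
  intro p
  rw [Finset.mem_filter, mem_pairs]
  simp [seg, and_assoc]

/-- decay bound -/
noncomputable def bd (K q m : ℕ) : ℝ := ((m:ℝ)+1)^K * ((√(q:ℝ))⁻¹)^m

lemma ind_nonneg {Γ : Type*} {q n : ℕ} (V : List Γ) (p : ℕ × ℕ) (W : Fin n → Fin q) :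
    0 ≤ ind V p W := by unfold ind; split_ifs <;> norm_num

lemma ind_le_one {Γ : Type*} {q n : ℕ} (V : List Γ) (p : ℕ × ℕ) (W : Fin n → Fin q) :
    ind V p W ≤ 1 := by unfold ind; split_ifs <;> norm_num

lemma exp_ind {Γ : Type*} [DecidableEq Γ] (V : List Γ) (hd : Doubled V) (q n : ℕ)
    (hq : 0 < q) (p : ℕ × ℕ) (hp : p.2 ≤ n) :
    (∑ W : Fin n → Fin q, ind V p W) / (q:ℝ)^n ≤ bd V.toFinset.card q (p.2 - p.1) := by
  classical
  unfold ind
  rw [Finset.sum_boole]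
  have h := card_bound V hd q n hq p hp
  have hm : p.2 - p.1 ≤ n := by omega
  generalize p.2 - p.1 = m at *
  have hq0 : (0:ℝ) < q := by exact_mod_cast hq
  have hq1 : (1:ℝ) ≤ q := by exact_mod_cast hq
  have hs : 0 < √(q:ℝ) := Real.sqrt_pos.2 hq0
  have hs1 : 1 ≤ √(q:ℝ) := Real.one_le_sqrt.2 hq1
  rw [div_le_iff₀ (by positivity)]
  have h' : ((Finset.univ.filter (fun W : Fin n → Fin q => IsInstance V (seg p W))).card : ℝ) ≤
      ((m:ℝ) + 1) ^ V.toFinset.card * (q:ℝ) ^ (m / 2) * (q:ℝ) ^ (n - m) := by exact_mod_cast h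
  refine h'.trans ?_
  unfold bd
  rw [mul_assoc, mul_assoc]
  apply mul_le_mul_of_nonneg_left _ (by positivity)
  have e1 : (q:ℝ)^n = √(q:ℝ)^m * √(q:ℝ)^m * (q:ℝ)^(n-m) := by
    rw [← mul_pow, Real.mul_self_sqrt hq0.le, ← pow_add]; congr 1; omega
  have e2 : (q:ℝ)^(m/2) ≤ √(q:ℝ)^m := by
    calc (q:ℝ)^(m/2) = √(q:ℝ)^(2*(m/2)) := by rw [pow_mul, Real.sq_sqrt hq0.le]
      _ ≤ _ := pow_le_pow_right₀ hs1 (by omega)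
  rw [e1, inv_pow]
  have : (√(q:ℝ)^m)⁻¹ * (√(q:ℝ)^m * √(q:ℝ)^m * (q:ℝ)^(n-m)) = √(q:ℝ)^m * (q:ℝ)^(n-m) := by
    field_simp
  rw [this]
  gcongr

/-- covariance -/
noncomputable def cov {Γ : Type*} (V : List Γ) (q n : ℕ) (p p' : ℕ × ℕ) : ℝ :=
  (∑ W : Fin n → Fin q, ind V p W * ind V p' W) / (q:ℝ)^n -
    ((∑ W : Fin n → Fin q, ind V p W) / (q:ℝ)^n) * ((∑ W : Fin n → Fin q, ind V p' W) / (q:ℝ)^n)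

lemma cov_comm {Γ : Type*} (V : List Γ) (q n : ℕ) (p p' : ℕ × ℕ) :
    cov V q n p p' = cov V q n p' p := by
  unfold cov
  simp only [mul_comm]

lemma cov_disj {Γ : Type*} (V : List Γ) (q n : ℕ) (hq : 0 < q) (p p' : ℕ × ℕ) (hp : p.2 ≤ n)
    (hp' : p'.2 ≤ n) (h : p.2 ≤ p'.1 ∨ p'.2 ≤ p.1) : cov V q n p p' = 0 := by
  have hq0 : (0:ℝ) < q := by exact_mod_cast hq
  have := indep (q := q) (n := n) (fun k => p.1 ≤ k ∧ k < p.2) (ind V p) (ind V p')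
    (by
      intro W W' hW
      unfold ind
      rw [(seg_eq_iff p hp W W').2 (fun k h1 h2 => hW k ⟨h1, h2⟩)])
    (by
      intro W W' hW
      unfold ind
      rw [(seg_eq_iff p' hp' W W').2 (fun k h1 h2 => hW k (by omega))])
  unfold cov
  rw [div_mul_div_comm, this]
  field_simp
  ring

lemma cov_le {Γ : Type*} [DecidableEq Γ] (V : List Γ) (hd : Doubled V) (q n : ℕ)
    (hq : 0 < q) (p p' : ℕ × ℕ) (hp : p.2 ≤ n) :
    cov V q n p p' ≤ bd V.toFinset.card q (p.2 - p.1) := by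
  have hq0 : (0:ℝ) < q := by exact_mod_cast hq
  refine le_trans ?_ (exp_ind V hd q n hq p hp)
  unfold cov
  have h1 : 0 ≤ ((∑ W : Fin n → Fin q, ind V p W) / (q:ℝ)^n) *
      ((∑ W : Fin n → Fin q, ind V p' W) / (q:ℝ)^n) :=
    mul_nonneg (div_nonneg (Finset.sum_nonneg fun _ _ => ind_nonneg _ _ _) (by positivity))
      (div_nonneg (Finset.sum_nonneg fun _ _ => ind_nonneg _ _ _) (by positivity))
  have h2 : (∑ W : Fin n → Fin q, ind V p W * ind V p' W) / (q:ℝ)^n ≤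
      (∑ W : Fin n → Fin q, ind V p W) / (q:ℝ)^n := by
    gcongr with W
    exact mul_le_of_le_one_right (ind_nonneg _ _ _) (ind_le_one _ _ _)
  linarith

lemma bd_nonneg (K q m : ℕ) : 0 ≤ bd K q m := by unfold bd; positivity

/-- pairs overlapping a given pair, at most as long -/
def near (n : ℕ) (p : ℕ × ℕ) : Finset (ℕ × ℕ) :=
  (pairs n).filter (fun p' => p'.1 < p.2 ∧ p.1 < p'.2 ∧ p'.2 - p'.1 ≤ p.2 - p.1)

lemma near_card (n : ℕ) (p : ℕ × ℕ) (hp : p.1 < p.2) :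
    (near n p).card ≤ (2 * (p.2 - p.1)) ^ 2 := by
  have : near n p ⊆ Finset.Ico (p.1 - (p.2 - p.1)) p.2 ×ˢ
      Finset.Ico (p.1 + 1) (p.2 + (p.2 - p.1) + 1) := by
    intro x hx
    simp only [near, Finset.mem_filter, mem_pairs] at hx
    simp only [Finset.mem_product, Finset.mem_Ico]
    omega
  refine (Finset.card_le_card this).trans ?_
  rw [Finset.card_product, Nat.card_Ico, Nat.card_Ico, sq]
  apply Nat.mul_le_mul <;> omega

lemma sum_cov_le {Γ : Type*} [DecidableEq Γ] (V : List Γ) (hd : Doubled V) (q n : ℕ)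
    (hq : 0 < q) :
    ∑ p ∈ pairs n, ∑ p' ∈ pairs n, cov V q n p p' ≤
      2 * ∑ p ∈ pairs n, ((2 * (p.2 - p.1)) ^ 2 : ℕ) * bd V.toFinset.card q (p.2 - p.1) := by
  classical
  let c : ℕ × ℕ → ℕ × ℕ → ℝ := fun p p' =>
    if p'.1 < p.2 ∧ p.1 < p'.2 ∧ p'.2 - p'.1 ≤ p.2 - p.1 then
      bd V.toFinset.card q (p.2 - p.1) else 0
  have hc0 : ∀ p p', 0 ≤ c p p' := by
    intro p p'; simp only [c]; split_ifs
    · exact bd_nonneg _ _ _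
    · exact le_rfl
  have h1 : ∀ p ∈ pairs n, ∀ p' ∈ pairs n, cov V q n p p' ≤ c p p' + c p' p := by
    intro p hp p' hp'
    rw [mem_pairs] at hp hp'
    by_cases hdis : p.2 ≤ p'.1 ∨ p'.2 ≤ p.1
    · rw [cov_disj V q n hq p p' hp.2 hp'.2 hdis]
      exact add_nonneg (hc0 _ _) (hc0 _ _)
    · rcases le_total (p'.2 - p'.1) (p.2 - p.1) with h | h
      · have : c p p' = bd V.toFinset.card q (p.2 - p.1) := if_pos (by omega)
        have h2 := cov_le V hd q n hq p p' hp.2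
        linarith [hc0 p' p]
      · have : c p' p = bd V.toFinset.card q (p'.2 - p'.1) := if_pos (by omega)
        have h2 := cov_le V hd q n hq p' p hp'.2
        rw [cov_comm] at h2
        linarith [hc0 p p']
  have h2 : ∑ p ∈ pairs n, ∑ p' ∈ pairs n, c p p' ≤
      ∑ p ∈ pairs n, ((2 * (p.2 - p.1)) ^ 2 : ℕ) * bd V.toFinset.card q (p.2 - p.1) := by
    apply Finset.sum_le_sum
    intro p hp
    simp only [c]
    rw [← Finset.sum_filter, Finset.sum_const, nsmul_eq_mul]
    apply mul_le_mul_of_nonneg_right _ (bd_nonneg _ _ _)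
    exact_mod_cast near_card n p (mem_pairs.1 hp).1
  calc _ ≤ ∑ p ∈ pairs n, ∑ p' ∈ pairs n, (c p p' + c p' p) :=
        Finset.sum_le_sum fun p hp => Finset.sum_le_sum fun p' hp' => h1 p hp p' hp'
    _ = 2 * ∑ p ∈ pairs n, ∑ p' ∈ pairs n, c p p' := by
        simp only [Finset.sum_add_distrib]
        rw [Finset.sum_comm (f := fun p p' => c p' p)]
        ring
    _ ≤ _ := by linarith

lemma summ (K q : ℕ) (hq : 2 ≤ q) :
    Summable (fun m : ℕ => ((2 * m) ^ 2 : ℕ) * bd K q m) := by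
  have hs : 1 < √(q:ℝ) := Real.lt_sqrt_of_sq_lt (by norm_num; omega)
  have hr : ‖(√(q:ℝ))⁻¹‖ < 1 := by
    rw [Real.norm_of_nonneg (by positivity)]
    exact inv_lt_one_of_one_lt₀ hs
  have h := (summable_pow_mul_geometric_of_norm_lt_one (K+2) hr).mul_left (4 * 2^K : ℝ)
  refine Summable.of_nonneg_of_le (fun m => mul_nonneg (by positivity) (bd_nonneg _ _ _)) ?_ h
  intro m
  unfold bd
  rcases Nat.eq_zero_or_pos m with rfl | hm
  · simp
  · have hm1 : (1:ℝ) ≤ m := by exact_mod_cast hm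
    have : ((m:ℝ)+1)^K ≤ (2 * (m:ℝ))^K := by gcongr; linarith
    push_cast
    calc (2 * (m:ℝ))^2 * (((m:ℝ)+1)^K * ((√(q:ℝ))⁻¹)^m)
        ≤ (2 * (m:ℝ))^2 * ((2 * (m:ℝ))^K * ((√(q:ℝ))⁻¹)^m) := by gcongr
      _ = _ := by rw [mul_pow, mul_pow]; ring

lemma sum_pairs_le (n : ℕ) (g : ℕ → ℝ) (hg : ∀ m, 0 ≤ g m) (hs : Summable g) :
    ∑ p ∈ pairs n, g (p.2 - p.1) ≤ (n+1) * ∑' m, g m := by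
  unfold pairs
  rw [Finset.sum_filter, Finset.sum_product]
  have : ∀ i ∈ Finset.range (n+1),
      ∑ j ∈ Finset.range (n+1), (if i < j then g (j - i) else 0) ≤ ∑' m, g m := by
    intro i _
    rw [← Finset.sum_filter]
    have hinj : Set.InjOn (fun j => j - i) ((Finset.range (n+1)).filter (fun j => i < j)) := by
      intro a ha b hb hab
      simp at ha hb hab
      omega
    rw [← Finset.sum_image (f := g) (g := fun j => j - i) hinj]
    exact hs.sum_le_tsum _ (fun m _ => hg m)
  calc _ ≤ ∑ i ∈ Finset.range (n+1), ∑' m, g m := Finset.sum_le_sum this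
    _ = _ := by simp

lemma var_eq {Γ : Type*} (V : List Γ) (q n : ℕ) (hq : 0 < q) :
    varDensity V q n = (∑ p ∈ pairs n, ∑ p' ∈ pairs n, cov V q n p p') /
      (((n+1).choose 2 : ℝ))^2 := by
  have hq0 : (0:ℝ) < q := by exact_mod_cast hq
  unfold varDensity expDensity instDensity
  simp only [count_eq, List.length_ofFn]
  set B : ℝ := ((n+1).choose 2 : ℝ)
  set Q : ℝ := (q:ℝ)^n with hQ
  have hQ0 : 0 < Q := by positivity
  have hcardQ : (∑ _W : Fin n → Fin q, (1:ℝ)) = Q := by simp [hQ]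
  set X : (Fin n → Fin q) → ℝ := fun W => ∑ p ∈ pairs n, ind V p W with hX
  have e1 : ∑ p ∈ pairs n, ∑ p' ∈ pairs n, cov V q n p p' =
      (∑ W, X W ^ 2) / Q - ((∑ W, X W) / Q)^2 := by
    unfold cov
    simp only [Finset.sum_sub_distrib, ← Finset.sum_div, ← Finset.mul_sum, ← Finset.sum_mul]
    have a1 : ∑ p ∈ pairs n, ∑ p' ∈ pairs n, ∑ W : Fin n → Fin q, ind V p W * ind V p' W =
        ∑ W, X W ^ 2 := by
      simp only [hX, sq, Finset.sum_mul_sum]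
      rw [Finset.sum_comm]
      conv_lhs => enter [2, y]; rw [Finset.sum_comm]
      rw [Finset.sum_comm]
      apply Finset.sum_congr rfl
      intro W _
      rw [Finset.sum_comm]
    have a2 : ∑ p ∈ pairs n, ∑ W : Fin n → Fin q, ind V p W = ∑ W, X W := by
      rw [Finset.sum_comm]
    rw [a1, a2, sq ((∑ W, X W) / Q)]
  rw [e1]
  have e2 : ∀ W, (X W / B - (∑ W, X W / B) / Q)^2 =
      (X W ^ 2 - 2 * ((∑ W, X W) / Q) * X W + ((∑ W, X W) / Q)^2 * 1) / B^2 := by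
    intro W
    rw [← Finset.sum_div, div_right_comm, ← sub_div, div_pow]
    ring
  change (∑ W, (X W / B - (∑ W, X W / B) / Q)^2) / Q = _
  rw [Finset.sum_congr rfl (fun W _ => e2 W)]
  rw [← Finset.sum_div, Finset.sum_add_distrib, Finset.sum_sub_distrib, ← Finset.mul_sum,
    ← Finset.mul_sum, hcardQ, div_right_comm]
  congr 1
  field_simp
  ring

end Stmt18Aux

theorem stmt18 {Γ : Type*} [DecidableEq Γ] (V : List Γ) (hV : V ≠ []) (hd : Doubled V)
    (q : ℕ) (hq : 2 ≤ q) :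
    ∃ C : ℝ, 0 < C ∧ ∃ N : ℕ, ∀ n : ℕ, N ≤ n →
      varDensity V q n ≤ C * (Real.log n) ^ 3 / (n : ℝ) ^ 3 := by
  set g : ℕ → ℝ := fun m => ((2 * m) ^ 2 : ℕ) * Stmt18Aux.bd V.toFinset.card q m with hg
  have hg0 : ∀ m, 0 ≤ g m := fun m => mul_nonneg (by positivity) (Stmt18Aux.bd_nonneg _ _ _)
  have hs : Summable g := Stmt18Aux.summ V.toFinset.card q hq
  have hS : 0 ≤ ∑' m, g m := tsum_nonneg hg0
  refine ⟨8 * (∑' m, g m) + 1, by positivity, 3, ?_⟩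
  intro n hn
  have hnr : (3:ℝ) ≤ n := by exact_mod_cast hn
  have hlog : 1 ≤ Real.log n := by
    rw [Real.le_log_iff_exp_le (by linarith)]
    linarith [Real.exp_one_lt_d9]
  rw [Stmt18Aux.var_eq V q n (by omega)]
  have h1 := Stmt18Aux.sum_cov_le V hd q n (by omega)
  have h2 := Stmt18Aux.sum_pairs_le n g hg0 hs
  have h3 : (((n+1).choose 2 : ℕ) : ℝ) = (n+1) * n / 2 := by
    rw [Nat.cast_choose_two]; push_cast; ring
  rw [h3]
  have h4 : ∑ p ∈ Stmt18Aux.pairs n, ∑ p' ∈ Stmt18Aux.pairs n, Stmt18Aux.cov V q n p p' ≤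
      2 * ((n+1) * ∑' m, g m) := by
    refine h1.trans ?_
    exact mul_le_mul_of_nonneg_left h2 (by norm_num)
  calc _ ≤ 2 * ((n+1) * ∑' m, g m) / (((n:ℝ)+1) * n / 2)^2 := by gcongr
    _ = 8 * (∑' m, g m) / ((n:ℝ)^2 * (n+1)) := by field_simp; ring
    _ ≤ (8 * (∑' m, g m) + 1) * (Real.log n) ^ 3 / ((n:ℝ)^2 * n) := by
        apply div_le_div₀
        · positivity
        · nlinarith [one_le_pow₀ hlog (n := 3)]
        · positivity
        · gcongr
          linarith
    _ = _ := by ring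
end

section
/- For every integer q ≥ 2, the limit I(Z₂,q) = lim_{n→∞} I_n(Z₂,q) exists and satisfies the strict inequalities 1/q < I(Z₂,q) < 1/(q−1), where Z₂ = aba is the second Zimin word. -/
open Filter

/-- `W` has a border of length `k`. -/
def Bord {q n : ℕ} (k : ℕ) (W : Fin n → Fin q) : Prop :=
  ∀ i j : Fin n, i.val < k → j.val + k = i.val + n → W i = W j

theorem inst_iff_list {β : Type*} (U : List β) :
    IsInstance (Zimin 2) U ↔ ∃ A B : List β, A ≠ [] ∧ B ≠ [] ∧ U = A ++ B ++ A := by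
  have hZ : Zimin 2 = [0, 1, 0] := by decide
  rw [hZ]
  constructor
  · rintro ⟨φ, h, rfl⟩
    exact ⟨φ 0, φ 1, h 0 (by simp), h 1 (by simp), by simp⟩
  · rintro ⟨A, B, hA, hB, rfl⟩
    refine ⟨fun x => if x = 0 then A else B, ?_, by simp⟩
    intro x _
    dsimp only
    split_ifs <;> assumption

theorem inst_iff {q n : ℕ} (W : Fin n → Fin q) :
    IsInstance (Zimin 2) (List.ofFn W) ↔ ∃ k, 1 ≤ k ∧ 2 * k < n ∧ Bord k W := by
  rw [inst_iff_list]
  constructor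
  · rintro ⟨A, B, hA, hB, h⟩
    have hA' := List.length_pos_iff.2 hA
    have hB' := List.length_pos_iff.2 hB
    have hl := congrArg List.length h
    simp only [List.length_ofFn, List.length_append] at hl
    refine ⟨A.length, hA', by omega, ?_⟩
    intro i j hi hj
    have e : ∀ i : Fin n, (List.ofFn W)[i.val]? = some (W i) := by
      intro i; simp
    have e1 := e i
    have e2 := e j
    rw [h] at e1 e2
    rw [List.append_assoc, List.getElem?_append_left hi] at e1
    rw [List.getElem?_append_right (by simp; omega)] at e2
    have : j.val - (A ++ B).length = i.val := by simp; omega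
    rw [this] at e2
    rw [e1] at e2
    exact Option.some.inj e2
  · rintro ⟨k, hk, hkn, hb⟩
    have hl : (List.ofFn W).length = n := by simp
    refine ⟨(List.ofFn W).take k, ((List.ofFn W).drop k).take (n - 2 * k), ?_, ?_, ?_⟩
    · rw [← List.length_pos_iff]; simp; omega
    · rw [← List.length_pos_iff]; simp; omega
    · apply List.ext_getElem
      · simp; omega
      · intro i h1 h2
        have hi : i < n := by simpa using h1
        by_cases c1 : i < k
        · rw [List.getElem_append_left (by simp; omega),
            List.getElem_append_left (by simp; omega)]
          simp
        · by_cases c2 : i < n - k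
          · rw [List.getElem_append_left (by simp; omega),
              List.getElem_append_right (by simp; omega)]
            simp only [List.getElem_take, List.getElem_drop, List.getElem_ofFn]
            congr 1
            apply Fin.ext
            simp; omega
          · rw [List.getElem_append_right (by simp; omega)]
            simp only [List.getElem_take, List.getElem_ofFn]
            symm
            apply hb
            · simp; omega
            · simp; omega

open Classical in
/-- The finite set of words with a short border. -/
noncomputable def S (q n : ℕ) : Finset (Fin n → Fin q) :=
  Finset.univ.filter fun W => ∃ k, 1 ≤ k ∧ 2 * k < n ∧ Bord k W

open Classical in
/-- The finite set of words with a border of length `k`. -/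
noncomputable def T (q n k : ℕ) : Finset (Fin n → Fin q) :=
  Finset.univ.filter fun W => Bord k W

theorem prob_eq (q n : ℕ) : instProb (Zimin 2) q n = ((S q n).card : ℝ) / (q : ℝ) ^ n := by
  classical
  unfold instProb S
  congr 2
  rw [Nat.card_eq_fintype_card, Fintype.card_subtype]
  congr 1
  ext W
  simp [inst_iff]

theorem T_card_le {q n k : ℕ} (h : 2 * k ≤ n) : (T q n k).card ≤ q ^ (n - k) := by
  classical
  have : q ^ (n - k) = (Finset.univ : Finset (Fin (n - k) → Fin q)).card := by simp
  rw [this]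
  apply Finset.card_le_card_of_injOn
    (fun W => fun i : Fin (n - k) => W ⟨i.val, by omega⟩) (by intro W _; simp)
  intro W hW W' hW' e
  simp only [T, Finset.coe_filter, Finset.mem_univ, true_and, Set.mem_ofPred_eq] at hW hW'
  funext j
  by_cases c : j.val < n - k
  · exact congrFun e ⟨j.val, c⟩
  · have a := hW ⟨j.val - (n - k), by omega⟩ j (by simp; omega) (by simp; omega)
    have a' := hW' ⟨j.val - (n - k), by omega⟩ j (by simp; omega) (by simp; omega)
    rw [← a, ← a']
    exact congrFun e ⟨j.val - (n - k), by omega⟩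

theorem Bord_insert {q n k : ℕ} (h : 2 * k ≤ n) (x : Fin q) (W : Fin n → Fin q) :
    Bord k (Fin.insertNth (α := fun _ => Fin q) (⟨n / 2, by omega⟩ : Fin (n + 1)) x W)
      ↔ Bord k W := by
  constructor
  · intro hb i j hi hj
    have := hb ((⟨n / 2, by omega⟩ : Fin (n + 1)).succAbove i)
      ((⟨n / 2, by omega⟩ : Fin (n + 1)).succAbove j)
    rw [Fin.insertNth_apply_succAbove, Fin.insertNth_apply_succAbove] at this
    rw [Fin.succAbove_of_castSucc_lt _ i (by simp [Fin.lt_def]; omega),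
      Fin.succAbove_of_le_castSucc _ j (by simp [Fin.le_def]; omega)] at this
    apply this
    · simpa using hi
    · simp; omega
  · intro hb i j hi hj
    have ei : i = (⟨n / 2, by omega⟩ : Fin (n + 1)).succAbove ⟨i.val, by omega⟩ := by
      rw [Fin.succAbove_of_castSucc_lt _ _ (by simp [Fin.lt_def]; omega)]
      rfl
    have ej : j = (⟨n / 2, by omega⟩ : Fin (n + 1)).succAbove ⟨j.val - 1, by omega⟩ := by
      rw [Fin.succAbove_of_le_castSucc _ _ (by simp [Fin.le_def]; omega)]
      apply Fin.ext
      simp; omega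
    refine ((congrArg _ ei).trans (Fin.insertNth_apply_succAbove _ _ _ _)).trans
      (Eq.trans ?_ ((congrArg _ ej).trans (Fin.insertNth_apply_succAbove _ _ _ _)).symm)
    apply hb
    · exact hi
    · simp; omega

/-- Insert a letter in the middle. -/
def ins (q n : ℕ) : (Fin q × (Fin n → Fin q)) ≃ (Fin (n + 1) → Fin q) :=
  Fin.insertNthEquiv (fun _ => Fin q) (⟨n / 2, by omega⟩ : Fin (n + 1))

theorem Bord_ins {q n k : ℕ} (h : 2 * k ≤ n) (p : Fin q × (Fin n → Fin q)) :
    Bord k (ins q n p) ↔ Bord k p.2 := Bord_insert h p.1 p.2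

theorem card_lift (q n : ℕ) :
    (((Finset.univ : Finset (Fin q)) ×ˢ S q n).map (ins q n).toEmbedding).card
      = q * (S q n).card := by
  simp

theorem S_lower (q n : ℕ) : q * (S q n).card ≤ (S q (n + 1)).card := by
  classical
  rw [← card_lift]
  apply Finset.card_le_card
  intro W hW
  simp only [Finset.mem_map, Finset.mem_product, S, Finset.mem_filter, Finset.mem_univ,
    true_and] at hW ⊢
  obtain ⟨p, ⟨k, h1, h2, h3⟩, rfl⟩ := hW
  exact ⟨k, h1, by omega, (Bord_ins (by omega) p).2 h3⟩

theorem S_upper (q n : ℕ) (m : ℕ) (hm : n = 2 * m) :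
    (S q (n + 1)).card ≤ q * (S q n).card + q ^ (n + 1 - m) := by
  classical
  rw [← card_lift]
  refine le_trans ?_ (Nat.add_le_add_left (T_card_le (q := q) (n := n + 1) (k := m) (by omega)) _)
  refine le_trans (Finset.card_le_card ?_) (Finset.card_union_le _ _)
  intro W hW
  simp only [Finset.mem_map, Finset.mem_product, S, T, Finset.mem_filter, Finset.mem_univ,
    true_and, Finset.mem_union] at hW ⊢
  obtain ⟨k, h1, h2, h3⟩ := hW
  by_cases c : k = m
  · right; rwa [← c]
  · left
    refine ⟨(ins q n).symm W, ⟨k, h1, by omega, ?_⟩, by simp⟩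
    rw [← Bord_ins (by omega)]
    simpa using h3

theorem S_upper' (q n : ℕ) (m : ℕ) (hm : n = 2 * m + 1) :
    (S q (n + 1)).card ≤ q * (S q n).card := by
  classical
  rw [← card_lift]
  refine (Finset.card_le_card ?_)
  intro W hW
  simp only [Finset.mem_map, Finset.mem_product, S, Finset.mem_filter, Finset.mem_univ,
    true_and] at hW ⊢
  obtain ⟨k, h1, h2, h3⟩ := hW
  refine ⟨(ins q n).symm W, ⟨k, h1, by omega, ?_⟩, by simp⟩
  rw [← Bord_ins (by omega)]
  simpa using h3

theorem S5_lower (q : ℕ) (hq : 2 ≤ q) : q ^ 4 < (S q 5).card := by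
  classical
  have h4 : q ^ 4 = ((Finset.univ : Finset (Fin 4 → Fin q)).image
      (fun V => (![V 0, V 1, V 2, V 3, V 0] : Fin 5 → Fin q))).card := by
    rw [Finset.card_image_of_injective]
    · simp
    · intro V V' h
      have h0 := congrFun h 0
      have h1 := congrFun h 1
      have h2 := congrFun h 2
      have h3 := congrFun h 3
      simp at h0 h1 h2 h3
      funext i
      fin_cases i <;> assumption
  rw [h4]
  apply Finset.card_lt_card
  rw [Finset.ssubset_iff_of_subset]
  · refine ⟨![⟨0, by omega⟩, ⟨1, by omega⟩, ⟨0, by omega⟩, ⟨0, by omega⟩, ⟨1, by omega⟩], ?_, ?_⟩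
    · simp only [S, Finset.mem_filter, Finset.mem_univ, true_and]
      refine ⟨2, by norm_num, by norm_num, ?_⟩
      intro i j hi hj
      fin_cases i <;> fin_cases j <;> simp at hi hj ⊢
    · simp only [Finset.mem_image, Finset.mem_univ, true_and, not_exists]
      intro V h
      have h0 := congrFun h 0
      have h1 := congrFun h 4
      simp at h0 h1
      rw [h0] at h1
      simp at h1
  · intro W hW
    simp only [Finset.mem_image, Finset.mem_univ, true_and] at hW
    obtain ⟨V, rfl⟩ := hW
    simp only [S, Finset.mem_filter, Finset.mem_univ, true_and]
    refine ⟨1, by norm_num, by norm_num, ?_⟩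
    intro i j hi hj
    fin_cases i <;> fin_cases j <;> simp at hi hj ⊢

theorem S5_upper (q : ℕ) (hq : 2 ≤ q) : (S q 5).card < q ^ 4 + q ^ 3 := by
  classical
  have h1 := T_card_le (q := q) (n := 5) (k := 1) (by norm_num)
  have h2 := T_card_le (q := q) (n := 5) (k := 2) (by norm_num)
  have h3 : (S q 5).card ≤ (T q 5 1 ∪ T q 5 2).card := by
    apply Finset.card_le_card
    intro W hW
    simp only [S, T, Finset.mem_filter, Finset.mem_univ, true_and, Finset.mem_union] at hW ⊢
    obtain ⟨k, a, b, c⟩ := hW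
    have : k = 1 ∨ k = 2 := by omega
    rcases this with rfl | rfl
    · exact Or.inl c
    · exact Or.inr c
  have h4 := Finset.card_union_add_card_inter (T q 5 1) (T q 5 2)
  have h5 : 0 < (T q 5 1 ∩ T q 5 2).card := by
    apply Finset.card_pos.2
    refine ⟨fun _ => ⟨0, by omega⟩, ?_⟩
    simp [T, Bord]
  norm_num at h1 h2
  omega

theorem stmt19 (q : ℕ) (hq : 2 ≤ q) :
    ∃ L : ℝ, Tendsto (fun n => instProb (Zimin 2) q n) atTop (nhds L) ∧
      1 / (q : ℝ) < L ∧ L < 1 / ((q : ℝ) - 1) := by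
  have hq2 : (2 : ℝ) ≤ q := by exact_mod_cast hq
  have hq0 : (0 : ℝ) < q := by linarith
  have hq1 : (0 : ℝ) < (q : ℝ) - 1 := by linarith
  set p : ℕ → ℝ := fun n => instProb (Zimin 2) q n with hp
  have hpe : ∀ n, p n = ((S q n).card : ℝ) / (q : ℝ) ^ n := fun n => prob_eq q n
  have mono : Monotone p := by
    apply monotone_nat_of_le_succ
    intro n
    rw [hpe, hpe, div_le_div_iff₀ (by positivity) (by positivity)]
    have : ((q : ℝ) * (S q n).card) ≤ (S q (n + 1)).card := by exact_mod_cast S_lower q n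
    calc ((S q n).card : ℝ) * (q : ℝ) ^ (n + 1) = (q * (S q n).card) * (q : ℝ) ^ n := by ring
      _ ≤ _ := by gcongr
  have up1 : ∀ m, p (2 * m + 1 + 1) ≤ p (2 * m + 1) := by
    intro m
    rw [hpe, hpe, div_le_div_iff₀ (by positivity) (by positivity)]
    have : ((S q (2 * m + 1 + 1)).card : ℝ) ≤ ((q : ℝ) * (S q (2 * m + 1)).card) := by
      exact_mod_cast S_upper' q (2 * m + 1) m rfl
    calc ((S q (2 * m + 1 + 1)).card : ℝ) * (q : ℝ) ^ (2 * m + 1)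
        ≤ (q * (S q (2 * m + 1)).card) * (q : ℝ) ^ (2 * m + 1) := by gcongr
      _ = _ := by ring
  have up2 : ∀ m, p (2 * m + 1) ≤ p (2 * m) + 1 / (q : ℝ) ^ m := by
    intro m
    rw [hpe, hpe]
    have h := S_upper q (2 * m) m rfl
    rw [show 2 * m + 1 - m = m + 1 by omega] at h
    have : ((S q (2 * m + 1)).card : ℝ) ≤ (q : ℝ) * (S q (2 * m)).card + (q : ℝ) ^ (m + 1) := by
      exact_mod_cast h
    rw [div_le_iff₀ (by positivity)]
    refine this.trans (le_of_eq ?_)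
    have e1 : (q : ℝ) ^ (2 * m + 1) = q ^ (2 * m) * q := by ring
    have e2 : (q : ℝ) ^ (2 * m + 1) = q ^ m * q ^ (m + 1) := by ring
    rw [add_mul]
    congr 1
    · rw [e1]; field_simp
    · rw [e2]; field_simp
  set C : ℝ := p 5 + 1 / (q : ℝ) ^ 2 / (q - 1) with hC
  have key : ∀ m, p (2 * (m + 2) + 1) + 1 / (q : ℝ) ^ (m + 2) / (q - 1) ≤ C := by
    intro m
    induction m with
    | zero => simp [hC]
    | succ m ih =>
      have a := up2 (m + 2 + 1)
      have b := up1 (m + 2)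
      have e : 1 / (q : ℝ) ^ (m + 2) / (q - 1)
          = 1 / (q : ℝ) ^ (m + 2 + 1) + 1 / (q : ℝ) ^ (m + 2 + 1) / (q - 1) := by
        have : (q : ℝ) - 1 ≠ 0 := hq1.ne'
        rw [pow_succ (q : ℝ) (m + 2)]
        field_simp
        ring
      have e3 : 2 * (m + 2 + 1) = 2 * (m + 2) + 1 + 1 := by ring
      have e4 : m + 1 + 2 = m + 2 + 1 := by ring
      rw [e4]
      rw [e3] at a ⊢
      linarith
  have bd : ∀ n, p n ≤ C := by
    intro n
    have h1 : p n ≤ p (2 * (n + 2) + 1) := mono (by omega)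
    have h2 := key n
    have h3 : 0 ≤ 1 / (q : ℝ) ^ (n + 2) / (q - 1) := by positivity
    linarith
  have bdd : BddAbove (Set.range p) := ⟨C, by rintro _ ⟨n, rfl⟩; exact bd n⟩
  refine ⟨⨆ n, p n, tendsto_atTop_ciSup mono bdd, ?_, ?_⟩
  · refine lt_of_lt_of_le ?_ (le_ciSup bdd 5)
    rw [hpe, div_lt_div_iff₀ (by positivity) (by positivity)]
    have : ((q : ℝ) ^ 4) < (S q 5).card := by exact_mod_cast S5_lower q hq
    nlinarith
  · refine lt_of_le_of_lt (ciSup_le bd) ?_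
    have : ((S q 5).card : ℝ) < (q : ℝ) ^ 4 + q ^ 3 := by exact_mod_cast S5_upper q hq
    have h5 : p 5 < 1 / q + 1 / (q : ℝ) ^ 2 := by
      rw [hpe, div_lt_iff₀ (by positivity)]
      refine this.trans_le (le_of_eq ?_)
      field_simp
    have e : 1 / ((q : ℝ) - 1) = 1 / q + 1 / (q : ℝ) ^ 2 + 1 / (q : ℝ) ^ 2 / (q - 1) := by
      have : (q : ℝ) - 1 ≠ 0 := hq1.ne'
      field_simp
      ring
    rw [hC, e]
    linarith
end
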